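/- Suppose λσ = 1, d₁ = y*/x*, d₂ = 0, a₁ + b₁ = 0, d₅ ≠ 0, Δ > 0 where Δ = (1 − c₂y*/x* − d₄y*/d₁)² − 4d₅(d₃(x*)² + c₁d₁x*), and −1 < c₂y*/x* < 1 − √Δ/2. Then there exist η > 0 and an integer k_min such that for every k ≥ k_min the map f has an asymptotically stable SR_k-solution (with parameter η) and a saddle SR_k-solution (with parameter η). -/

import Mathlib

open Filter Metric

noncomputable section

/-- Jacobian matrix of a planar map at a point. -/
def jac (T : ℝ × ℝ → ℝ × ℝ) (z : ℝ × ℝ) : Matrix (Fin 2) (Fin 2) ℝ :=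
  !![fderiv ℝ (fun p => (T p).1) z (1, 0), fderiv ℝ (fun p => (T p).1) z (0, 1);
     fderiv ℝ (fun p => (T p).2) z (1, 0), fderiv ℝ (fun p => (T p).2) z (0, 1)]

/-- The forward orbit of a point under a planar map. -/
def orbit (f : ℝ × ℝ → ℝ × ℝ) (p : ℝ × ℝ) : Set (ℝ × ℝ) :=
  Set.range fun n : ℕ => f^[n] p

/-- A periodic orbit (through `p`) is Lyapunov stable if every forward orbit starting
close enough to the orbit stays close to it. -/
def LyapStable (f : ℝ × ℝ → ℝ × ℝ) (p : ℝ × ℝ) : Prop :=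
  ∀ ε > 0, ∃ δ > 0, ∀ q : ℝ × ℝ, infDist q (orbit f p) < δ →
    ∀ n : ℕ, infDist (f^[n] q) (orbit f p) < ε

/-- Asymptotic stability: Lyapunov stability together with local attractivity. -/
def AsympStable (f : ℝ × ℝ → ℝ × ℝ) (p : ℝ × ℝ) : Prop :=
  LyapStable f p ∧ ∃ δ > 0, ∀ q : ℝ × ℝ, infDist q (orbit f p) < δ →
    Tendsto (fun n : ℕ => infDist (f^[n] q) (orbit f p)) atTop (nhds 0)

/-- A periodic point `p` of period `n` is a saddle if the Jacobian of `f^[n]` at `p`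
has real eigenvalues `μ₁, μ₂` with `|μ₁| < 1 < |μ₂|`. -/
def IsSaddle (f : ℝ × ℝ → ℝ × ℝ) (n : ℕ) (p : ℝ × ℝ) : Prop :=
  ∃ μ₁ μ₂ : ℝ, μ₁ + μ₂ = Matrix.trace (jac (f^[n]) p) ∧
    μ₁ * μ₂ = (jac (f^[n]) p).det ∧ |μ₁| < 1 ∧ 1 < |μ₂|

/-- The set `N_η = {(x,y) ∈ N : |xy| < η}`. -/
def Nset (N : Set (ℝ × ℝ)) (η : ℝ) : Set (ℝ × ℝ) := {p ∈ N | |p.1 * p.2| < η}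

/-- `z 0, …, z k` are points of an `SR_k`-solution (with parameter `η`). -/
def IsSRSol (f T₁ : ℝ × ℝ → ℝ × ℝ) (N : Set (ℝ × ℝ)) (η : ℝ) (m k : ℕ)
    (z : ℕ → ℝ × ℝ) : Prop :=
  f^[k + m] (z 0) = z 0 ∧
  (∀ j : ℕ, 0 < j → j < k + m → f^[j] (z 0) ≠ z 0) ∧
  (∀ j < k, z (j + 1) = f (z j)) ∧
  (∀ j < k, z j ∈ Nset N η) ∧
  z 0 = T₁ (z k)

/-- The Taylor expansion of `T₁` at `(0, ys)` has the indicated coefficients. -/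
def TaylorExp (T₁ : ℝ × ℝ → ℝ × ℝ) (xs ys c₁ c₂ d₁ d₂ d₃ d₄ d₅ : ℝ) : Prop :=
  ∃ C > 0, ∃ ε > 0, ∀ x v : ℝ, |x| < ε → |v| < ε →
    |(T₁ (x, ys + v)).1 - (xs + c₁ * x + c₂ * v)| ≤ C * (|x| + |v|) ^ 2 ∧
    |(T₁ (x, ys + v)).2 - (d₁ * x + d₂ * v + d₃ * x ^ 2 + d₄ * x * v + d₅ * v ^ 2)|
      ≤ C * (|x| + |v|) ^ 3

section C1Lim

open scoped Topology

variable {E F G : Type*} [NormedAddCommGroup E] [NormedSpace ℝ E]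
  [NormedAddCommGroup F] [NormedSpace ℝ F] [NormedAddCommGroup G] [NormedSpace ℝ G]

/-- Continuous `C¹`-convergence of a sequence of maps at a point: the values and the derivatives
of `Φ k` at `p` tend to `y₀` and `L` as `k → ∞` and `p → p₀` jointly. -/
structure C1Lim (Φ : ℕ → E → F) (p₀ : E) (y₀ : F) (L : E →L[ℝ] F) : Prop where
  tendsto : Tendsto (fun q : ℕ × E => Φ q.1 q.2) (atTop ×ˢ 𝓝 p₀) (𝓝 y₀)
  differentiable : ∀ᶠ q : ℕ × E in atTop ×ˢ 𝓝 p₀, DifferentiableAt ℝ (Φ q.1) q.2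
  tendsto_fderiv : Tendsto (fun q : ℕ × E => fderiv ℝ (Φ q.1) q.2) (atTop ×ˢ 𝓝 p₀) (𝓝 L)

theorem eventually_eventually_nhds_of_prod {E : Type*} [TopologicalSpace E] {p₀ : E}
    {R : ℕ → E → Prop}
    (h : ∀ᶠ q : ℕ × E in atTop ×ˢ 𝓝 p₀, R q.1 q.2) :
    ∀ᶠ q : ℕ × E in atTop ×ˢ 𝓝 p₀, ∀ᶠ p in 𝓝 q.2, R q.1 p := by
  obtain ⟨pa, ha, pb, hb, hab⟩ := eventually_prod_iff.1 h
  refine eventually_prod_iff.2 ⟨pa, ha, _, eventually_eventually_nhds.2 hb, ?_⟩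
  intro k hk p hp
  exact hp.mono fun y hy => hab hk hy

namespace C1Lim

variable {Φ Ψ : ℕ → E → F} {p₀ : E} {y₀ y₁ : F} {L M : E →L[ℝ] F}

theorem of_hasFDerivAt {Φ' : ℕ → E → E →L[ℝ] F}
    (h₁ : Tendsto (fun q : ℕ × E => Φ q.1 q.2) (atTop ×ˢ 𝓝 p₀) (𝓝 y₀))
    (h₂ : ∀ᶠ q : ℕ × E in atTop ×ˢ 𝓝 p₀, HasFDerivAt (Φ q.1) (Φ' q.1 q.2) q.2)
    (h₃ : Tendsto (fun q : ℕ × E => Φ' q.1 q.2) (atTop ×ˢ 𝓝 p₀) (𝓝 L)) :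
    C1Lim Φ p₀ y₀ L :=
  ⟨h₁, h₂.mono fun _ h => h.differentiableAt,
    h₃.congr' (h₂.mono fun _ h => h.fderiv.symm)⟩

theorem congr (h : C1Lim Φ p₀ y₀ L)
    (he : ∀ᶠ q : ℕ × E in atTop ×ˢ 𝓝 p₀, Ψ q.1 q.2 = Φ q.1 q.2) : C1Lim Ψ p₀ y₀ L := by
  refine of_hasFDerivAt (Φ' := fun k p => fderiv ℝ (Φ k) p)
    (h.tendsto.congr' (he.mono fun _ h => h.symm)) ?_ h.tendsto_fderiv
  filter_upwards [h.differentiable,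
    eventually_eventually_nhds_of_prod (R := fun k p => Ψ k p = Φ k p) he] with q hq hq'
  exact hq.hasFDerivAt.congr_of_eventuallyEq hq'

theorem const {c : ℕ → F} (hc : Tendsto c atTop (𝓝 y₀)) : C1Lim (fun k _ => c k) p₀ y₀ 0 :=
  of_hasFDerivAt (Φ' := fun _ _ => 0) (hc.comp tendsto_fst)
    (Eventually.of_forall fun _ => hasFDerivAt_const _ _) tendsto_const_nhds

theorem clm (T : E →L[ℝ] F) : C1Lim (fun _ p => T p) p₀ (T p₀) T :=
  of_hasFDerivAt (Φ' := fun _ _ => T) ((T.continuous.tendsto p₀).comp tendsto_snd)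
    (Eventually.of_forall fun _ => T.hasFDerivAt) tendsto_const_nhds

theorem add (h : C1Lim Φ p₀ y₀ L) (h' : C1Lim Ψ p₀ y₁ M) :
    C1Lim (fun k p => Φ k p + Ψ k p) p₀ (y₀ + y₁) (L + M) :=
  of_hasFDerivAt (Φ' := fun k p => fderiv ℝ (Φ k) p + fderiv ℝ (Ψ k) p) (h.tendsto.add h'.tendsto)
    (by filter_upwards [h.differentiable, h'.differentiable] with q h1 h2
        exact h1.hasFDerivAt.add h2.hasFDerivAt)
    (h.tendsto_fderiv.add h'.tendsto_fderiv)

theorem sub (h : C1Lim Φ p₀ y₀ L) (h' : C1Lim Ψ p₀ y₁ M) :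
    C1Lim (fun k p => Φ k p - Ψ k p) p₀ (y₀ - y₁) (L - M) :=
  of_hasFDerivAt (Φ' := fun k p => fderiv ℝ (Φ k) p - fderiv ℝ (Ψ k) p) (h.tendsto.sub h'.tendsto)
    (by filter_upwards [h.differentiable, h'.differentiable] with q h1 h2
        exact h1.hasFDerivAt.sub h2.hasFDerivAt)
    (h.tendsto_fderiv.sub h'.tendsto_fderiv)

theorem mul {φ ψ : ℕ → E → ℝ} {a b : ℝ} {L M : E →L[ℝ] ℝ} (h : C1Lim φ p₀ a L)
    (h' : C1Lim ψ p₀ b M) : C1Lim (fun k p => φ k p * ψ k p) p₀ (a * b) (a • M + b • L) :=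
  of_hasFDerivAt (Φ' := fun k p => φ k p • fderiv ℝ (ψ k) p + ψ k p • fderiv ℝ (φ k) p)
    (h.tendsto.mul h'.tendsto)
    (by filter_upwards [h.differentiable, h'.differentiable] with q h1 h2
        exact h1.hasFDerivAt.mul h2.hasFDerivAt)
    ((h.tendsto.smul h'.tendsto_fderiv).add (h'.tendsto.smul h.tendsto_fderiv))

theorem prodMk {Ψ : ℕ → E → G} {y₁ : G} {M : E →L[ℝ] G}
    (h : C1Lim Φ p₀ y₀ L) (h' : C1Lim Ψ p₀ y₁ M) :
    C1Lim (fun k p => (Φ k p, Ψ k p)) p₀ (y₀, y₁) (L.prod M) := by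
  refine of_hasFDerivAt (Φ' := fun k p => (fderiv ℝ (Φ k) p).prod (fderiv ℝ (Ψ k) p))
    (h.tendsto.prodMk_nhds h'.tendsto)
    (by filter_upwards [h.differentiable, h'.differentiable] with q h1 h2
        exact h1.hasFDerivAt.prodMk h2.hasFDerivAt) ?_
  exact ((ContinuousLinearMap.prodₗᵢ (R := ℝ) (𝕜 := ℝ) (E := E) (F := F) (G := G)).continuous.tendsto
    (L, M)).comp (h.tendsto_fderiv.prodMk_nhds h'.tendsto_fderiv)

theorem comp {Ψ : ℕ → F → G} {z₀ : G} {M : F →L[ℝ] G}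
    (h' : C1Lim Ψ y₀ z₀ M) (h : C1Lim Φ p₀ y₀ L) :
    C1Lim (fun k p => Ψ k (Φ k p)) p₀ z₀ (M.comp L) := by
  have ht : Tendsto (fun q : ℕ × E => (q.1, Φ q.1 q.2)) (atTop ×ˢ 𝓝 p₀) (atTop ×ˢ 𝓝 y₀) :=
    tendsto_fst.prodMk h.tendsto
  refine of_hasFDerivAt
    (Φ' := fun k p => (fderiv ℝ (Ψ k) (Φ k p)).comp (fderiv ℝ (Φ k) p)) (h'.tendsto.comp ht)
    (by filter_upwards [h.differentiable, ht.eventually h'.differentiable] with q h1 h2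
        exact h2.hasFDerivAt.comp q.2 h1.hasFDerivAt) ?_
  exact (isBoundedBilinearMap_comp.continuous.tendsto (M, L)).comp
    ((h'.tendsto_fderiv.comp ht).prodMk_nhds h.tendsto_fderiv)

/-- Nondegenerate zeros of the limit persist. -/
theorem exists_zero [CompleteSpace E] {Φ : ℕ → E → F} {e : E ≃L[ℝ] F}
    (h : C1Lim Φ p₀ 0 (e : E →L[ℝ] F)) {R : ℕ → E → Prop}
    (hR : ∀ᶠ q : ℕ × E in atTop ×ˢ 𝓝 p₀, R q.1 q.2) :
    ∀ᶠ k in atTop, ∃ p, Φ k p = 0 ∧ R k p := by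
  rcases subsingleton_or_nontrivial E with hE | hE
  · have : Subsingleton F := e.symm.injective.subsingleton
    filter_upwards [hR.curry] with k hk
    exact ⟨p₀, Subsingleton.elim _ _, hk.self_of_nhds⟩
  set c : NNReal := ‖(e.symm : F →L[ℝ] E)‖₊⁻¹ / 2 with hc
  have hpos : 0 < ‖(e.symm : F →L[ℝ] E)‖₊⁻¹ := by
    rw [inv_pos]; exact e.nnnorm_symm_pos
  have hcpos : 0 < c := half_pos hpos
  have hev := h.tendsto_fderiv.eventually (Metric.ball_mem_nhds (e : E →L[ℝ] F) hcpos)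
  obtain ⟨pa, ha, pb, hb, hab⟩ := eventually_prod_iff.1 (hev.and (h.differentiable.and hR))
  obtain ⟨r, hr, hball⟩ := Metric.eventually_nhds_iff.1 hb
  have h0 : Tendsto (fun k => Φ k p₀) atTop (𝓝 0) :=
    h.tendsto.comp (tendsto_id.prodMk (tendsto_const_nhds (x := p₀)))
  have hrad : 0 < ((‖(e.symm : F →L[ℝ] E)‖₊⁻¹ : NNReal) - c : ℝ) * (r / 2) := by
    have : (c : ℝ) < (‖(e.symm : F →L[ℝ] E)‖₊⁻¹ : NNReal) := by exact_mod_cast half_lt_self hpos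
    have := sub_pos.2 this
    positivity
  filter_upwards [ha, h0.eventually (Metric.closedBall_mem_nhds 0 hrad)] with k hk hk0
  have happ : ApproximatesLinearOn (Φ k) (e : E →L[ℝ] F) (Metric.closedBall p₀ (r / 2)) c := by
    intro x hx y hy
    refine (convex_closedBall p₀ (r / 2)).norm_image_sub_le_of_norm_hasFDerivWithin_le'
      (f' := fun p => fderiv ℝ (Φ k) p) ?_ ?_ hy hx
    · intro p hp
      exact (hab hk (hball (lt_of_le_of_lt hp (by linarith)))).2.1.hasFDerivAt.hasFDerivWithinAt
    · intro p hp
      have := (hab hk (hball (lt_of_le_of_lt hp (by linarith)))).1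
      rw [← dist_eq_norm]
      exact le_of_lt this
  have hsurj := happ.surjOn_closedBall_of_nonlinearRightInverse e.toNonlinearRightInverse
    (ε := r / 2) (by linarith) subset_rfl
  have hmem : (0 : F) ∈ Metric.closedBall (Φ k p₀)
      (((e.toNonlinearRightInverse.nnnorm : ℝ)⁻¹ - c) * (r / 2)) := by
    rw [Metric.mem_closedBall, dist_comm]
    simpa [ContinuousLinearEquiv.toNonlinearRightInverse] using hk0
  obtain ⟨p, hp, hp0⟩ := hsurj hmem
  exact ⟨p, hp0, (hab hk (hball (lt_of_le_of_lt hp (by linarith)))).2.2⟩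

end C1Lim

end C1Lim

section CocycleEstimates

/-- The factor `∏ⱼ (1 + uⱼ A(uⱼ))` accumulated along the orbit `uⱼ = g^j(u)`. -/
def cocycle (g A : ℝ → ℝ) (k : ℕ) (u : ℝ) : ℝ :=
  ∏ j ∈ Finset.range k, (1 + g^[j] u * A (g^[j] u))

theorem cocycle_succ (g A : ℝ → ℝ) (k : ℕ) (u : ℝ) :
    cocycle g A (k + 1) u = cocycle g A k u * (1 + g^[k] u * A (g^[k] u)) :=
  Finset.prod_range_succ _ _

theorem exists_abs_le_of_continuous {φ : ℝ → ℝ} (h : Continuous φ) :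
    ∃ M > 0, ∀ u, |u| ≤ 1 → |φ u| ≤ M := by
  obtain ⟨M, hM⟩ := (isCompact_Icc (a := (-1 : ℝ)) (b := 1)).exists_bound_of_continuousOn
    h.continuousOn
  exact ⟨max M 1, by positivity, fun u hu =>
    (hM u (abs_le.1 hu)).trans (le_max_left _ _)⟩

theorem exists_abs_sub_le_of_contDiff {φ : ℝ → ℝ} (h : ContDiff ℝ 1 φ) :
    ∃ M > 0, ∀ u, |u| ≤ 1 → |φ u - φ 0| ≤ M * |u| := by
  obtain ⟨M, hM0, hM⟩ := exists_abs_le_of_continuous (h.continuous_deriv le_rfl)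
  refine ⟨M, hM0, fun u hu => ?_⟩
  have := (convex_Icc (-1 : ℝ) 1).norm_image_sub_le_of_norm_deriv_le (f := φ) (C := M)
    (x := 0) (y := u) (fun x _ => (h.differentiable one_ne_zero) x)
    (fun x hx => hM x (abs_le.2 hx)) (show (0 : ℝ) ∈ Set.Icc (-1) 1 by simp)
    (show u ∈ Set.Icc (-1 : ℝ) 1 from abs_le.1 hu)
  simpa using this

theorem abs_iterate_sub_le {g : ℝ → ℝ} {C : ℝ} (hC : 1 ≤ C)
    (hg : ∀ u, |u| ≤ 1 → |g u - u| ≤ C * |u| ^ 3) {k : ℕ} {u : ℝ}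
    (hu : 8 * C * |u| ≤ 1) (hku : 8 * C * (k * |u|) ≤ 1) :
    |g^[k] u - u| ≤ 8 * C * k * |u| ^ 3 ∧ |g^[k] u| ≤ 2 * |u| := by
  have h0 := abs_nonneg u
  have hu1 : |u| ≤ 1 / 8 := by nlinarith
  have key : ∀ j : ℕ, 8 * C * (j * |u|) ≤ 1 → |g^[j] u - u| ≤ 8 * C * j * |u| ^ 3 →
      |g^[j] u| ≤ 2 * |u| := by
    intro j hj h
    have h1 : |g^[j] u| ≤ |g^[j] u - u| + |u| := by
      simpa using abs_add_le (g^[j] u - u) u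
    have h2 : 8 * C * j * |u| ^ 3 ≤ |u| := by
      have : 8 * C * j * |u| ^ 3 = (8 * C * (j * |u|)) * (|u| * |u|) := by ring
      rw [this]
      nlinarith [mul_nonneg h0 h0]
    linarith
  suffices h : |g^[k] u - u| ≤ 8 * C * k * |u| ^ 3 from ⟨h, key k hku h⟩
  induction k with
  | zero => simp
  | succ k ih =>
    push_cast at hku ⊢
    have hk : 8 * C * (k * |u|) ≤ 1 := by nlinarith
    have h1 := ih hk
    have h2 := key k hk h1
    rw [Function.iterate_succ_apply']
    have h3 := hg (g^[k] u) (by linarith)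
    have h4 : C * |g^[k] u| ^ 3 ≤ C * (2 * |u|) ^ 3 := by gcongr
    have h5 : |g (g^[k] u) - u| ≤ |g (g^[k] u) - g^[k] u| + |g^[k] u - u| := abs_sub_le _ _ _
    nlinarith

theorem pow_one_add_le_three {x : ℝ} (hx : 0 ≤ x) {k j : ℕ} (hj : j ≤ 2 * k)
    (h : 2 * (k * x) ≤ 1) : (1 + x) ^ j ≤ 3 := by
  have h1 : (1 + x) ^ j ≤ Real.exp x ^ j := by
    gcongr
    linarith [Real.add_one_le_exp x]
  have h2 : Real.exp x ^ j = Real.exp (j * x) := (Real.exp_nat_mul x j).symm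
  have hj' : (j : ℝ) ≤ 2 * k := by exact_mod_cast hj
  have h3 : Real.exp (j * x) ≤ Real.exp 1 := Real.exp_le_exp.2 (by nlinarith)
  linarith [Real.exp_one_lt_d9]

theorem abs_deriv_iterate_le {g : ℝ → ℝ} {C : ℝ} (hC : 1 ≤ C) (hgd : Differentiable ℝ g)
    (hg : ∀ u, |u| ≤ 1 → |g u - u| ≤ C * |u| ^ 3)
    (hg' : ∀ u, |u| ≤ 1 → |deriv g u - 1| ≤ C * |u|) {k : ℕ} {u : ℝ}
    (hu : 8 * C * |u| ≤ 1) (hku : 8 * C * (k * |u|) ≤ 1) :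
    |deriv (g^[k]) u| ≤ (1 + 2 * C * |u|) ^ k := by
  induction k with
  | zero => simp
  | succ k ih =>
    push_cast at hku
    have h0 := abs_nonneg u
    have hk : 8 * C * (k * |u|) ≤ 1 := by nlinarith
    have h1 := (abs_iterate_sub_le hC hg hu hk).2
    have h2 := hg' (g^[k] u) (by nlinarith)
    have h3 : |deriv g (g^[k] u)| ≤ 1 + 2 * C * |u| := by
      have : |deriv g (g^[k] u)| ≤ |deriv g (g^[k] u) - 1| + |(1 : ℝ)| := by
        simpa using abs_add_le (deriv g (g^[k] u) - 1) 1
      rw [abs_one] at this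
      nlinarith
    rw [Function.iterate_succ', deriv_comp u (hgd _) (hgd.iterate k u), abs_mul, pow_succ']
    exact mul_le_mul h3 (ih hk) (abs_nonneg _) (by positivity)

theorem differentiable_cocycle {g A : ℝ → ℝ} (hg : Differentiable ℝ g) (hA : Differentiable ℝ A)
    (k : ℕ) : Differentiable ℝ (cocycle g A k) := by
  unfold cocycle
  have := fun j => hg.iterate j
  fun_prop

theorem abs_one_add_le {a C u x : ℝ} (hx : |x| ≤ 2 * |u|) (ha : |a| ≤ C) :
    |x * a| ≤ 2 * C * |u| ∧ |1 + x * a| ≤ 1 + 2 * C * |u| := by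
  have h : |x * a| ≤ 2 * C * |u| := by
    rw [abs_mul]
    calc |x| * |a| ≤ (2 * |u|) * C := by gcongr
      _ = 2 * C * |u| := by ring
  refine ⟨h, ?_⟩
  have := abs_add_le 1 (x * a)
  rw [abs_one] at this
  linarith

theorem abs_cocycle_le {g A : ℝ → ℝ} {C : ℝ} (hC : 1 ≤ C)
    (hg : ∀ u, |u| ≤ 1 → |g u - u| ≤ C * |u| ^ 3)
    (hA : ∀ u, |u| ≤ 1 → |A u| ≤ C) {k : ℕ} {u : ℝ}
    (hu : 8 * C * |u| ≤ 1) (hku : 8 * C * (k * |u|) ≤ 1) :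
    |cocycle g A k u| ≤ (1 + 2 * C * |u|) ^ k ∧ |cocycle g A k u - 1| ≤ 6 * C * k * |u| := by
  have h0 := abs_nonneg u
  induction k with
  | zero => simp [cocycle]
  | succ j ih =>
    push_cast at hku
    have hj : 8 * C * (j * |u|) ≤ 1 := by nlinarith
    obtain ⟨i1, i2⟩ := ih hj
    have o2 := (abs_iterate_sub_le hC hg hu hj).2
    set v := g^[j] u with hv
    obtain ⟨hvA, hfac⟩ := abs_one_add_le o2 (hA v (by nlinarith))
    have hbj : (1 + 2 * C * |u|) ^ j ≤ 3 :=
      pow_one_add_le_three (by positivity) (k := j) (by lia) (by nlinarith)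
    rw [cocycle_succ]
    constructor
    · rw [abs_mul, pow_succ]
      gcongr
    · have e : cocycle g A j u * (1 + v * A v) - 1
          = (cocycle g A j u - 1) + cocycle g A j u * (v * A v) := by ring
      rw [e]
      refine (abs_add_le _ _).trans ?_
      rw [abs_mul]
      have : |cocycle g A j u| * |v * A v| ≤ 3 * (2 * C * |u|) := by
        gcongr
        linarith
      push_cast
      linarith

theorem abs_cocycle_sub_le {g A : ℝ → ℝ} {C : ℝ} (hC : 1 ≤ C)
    (hg : ∀ u, |u| ≤ 1 → |g u - u| ≤ C * |u| ^ 3)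
    (hA : ∀ u, |u| ≤ 1 → |A u| ≤ C) (hA0 : ∀ u, |u| ≤ 1 → |A u - A 0| ≤ C * |u|)
    {k : ℕ} {u : ℝ} (hu : 8 * C * |u| ≤ 1) (hku : 8 * C * (k * |u|) ≤ 1) :
    |cocycle g A k u - 1 - k * A 0 * u| ≤ 20 * C ^ 2 * k ^ 2 * u ^ 2 := by
  have h0 := abs_nonneg u
  have hu1 : 8 * |u| ≤ 1 := by nlinarith
  rw [← sq_abs u]
  induction k with
  | zero => simp [cocycle]
  | succ j ih =>
    push_cast at hku
    have hj : 8 * C * (j * |u|) ≤ 1 := by nlinarith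
    have i3 := ih hj
    have i2 := (abs_cocycle_le hC hg hA hu hj).2
    obtain ⟨o1, o2⟩ := abs_iterate_sub_le hC hg hu hj
    rw [cocycle_succ]
    set v := g^[j] u with hv
    have hv1 : |v| ≤ 1 := by linarith
    have a2 := hA0 v hv1
    have hvA := (abs_one_add_le o2 (hA v hv1)).1
    have e : cocycle g A j u * (1 + v * A v) - 1 - ((j + 1 : ℕ) : ℝ) * A 0 * u
        = (cocycle g A j u - 1 - j * A 0 * u) + (cocycle g A j u - 1) * (v * A v)
          + v * (A v - A 0) + A 0 * (v - u) := by push_cast; ring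
    have t1 : |(cocycle g A j u - 1) * (v * A v)| ≤ 12 * C ^ 2 * j * |u| ^ 2 := by
      rw [abs_mul]
      calc _ ≤ (6 * C * j * |u|) * (2 * C * |u|) := by gcongr
        _ = _ := by ring
    have t2 : |v * (A v - A 0)| ≤ 4 * C ^ 2 * |u| ^ 2 := by
      rw [abs_mul]
      calc _ ≤ (2 * |u|) * (C * (2 * |u|)) := by gcongr; exact a2.trans (by gcongr)
        _ = 4 * (C * 1) * |u| ^ 2 := by ring
        _ ≤ 4 * (C * C) * |u| ^ 2 := by gcongr
        _ = _ := by ring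
    have t3 : |A 0 * (v - u)| ≤ C ^ 2 * j * |u| ^ 2 := by
      rw [abs_mul]
      calc _ ≤ C * (8 * C * j * |u| ^ 3) := by gcongr; exact hA 0 (by simp)
        _ = C ^ 2 * j * |u| ^ 2 * (8 * |u|) := by ring
        _ ≤ C ^ 2 * j * |u| ^ 2 * 1 := by gcongr
        _ = _ := by ring
    have b1 := abs_add_le ((cocycle g A j u - 1 - j * A 0 * u) +
      (cocycle g A j u - 1) * (v * A v) + v * (A v - A 0)) (A 0 * (v - u))
    have b2 := abs_add_le ((cocycle g A j u - 1 - j * A 0 * u) +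
      (cocycle g A j u - 1) * (v * A v)) (v * (A v - A 0))
    have b3 := abs_add_le (cocycle g A j u - 1 - j * A 0 * u) ((cocycle g A j u - 1) * (v * A v))
    have p1 : (0:ℝ) ≤ C ^ 2 * |u| ^ 2 := by positivity
    have p2 : (0:ℝ) ≤ C ^ 2 * j * |u| ^ 2 := by positivity
    have e2 : 20 * C ^ 2 * ((j + 1 : ℕ) : ℝ) ^ 2 * |u| ^ 2 = 20 * C ^ 2 * j ^ 2 * |u| ^ 2
      + 40 * (C ^ 2 * j * |u| ^ 2) + 20 * (C ^ 2 * |u| ^ 2) := by push_cast; ring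
    rw [e, e2]
    linarith

theorem abs_deriv_cocycle_le {g A : ℝ → ℝ} {C : ℝ} (hC : 1 ≤ C) (hgd : Differentiable ℝ g)
    (hAd : Differentiable ℝ A)
    (hg : ∀ u, |u| ≤ 1 → |g u - u| ≤ C * |u| ^ 3)
    (hg' : ∀ u, |u| ≤ 1 → |deriv g u - 1| ≤ C * |u|)
    (hA : ∀ u, |u| ≤ 1 → |A u| ≤ C)
    (hA' : ∀ u, |u| ≤ 1 → |deriv (fun v => 1 + v * A v) u| ≤ C) {k : ℕ} {u : ℝ}
    (hu : 8 * C * |u| ≤ 1) (hku : 8 * C * (k * |u|) ≤ 1) :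
    |deriv (cocycle g A k) u| ≤ 3 * C * k := by
  have h0 := abs_nonneg u
  suffices h : |deriv (cocycle g A k) u| ≤ C * k * (1 + 2 * C * |u|) ^ (2 * k) by
    have hb : (1 + 2 * C * |u|) ^ (2 * k) ≤ 3 :=
      pow_one_add_le_three (by positivity) (k := k) le_rfl (by nlinarith)
    calc _ ≤ _ := h
      _ ≤ C * k * 3 := by gcongr
      _ = _ := by ring
  induction k with
  | zero =>
    have : cocycle g A 0 = fun _ => 1 := by funext; simp [cocycle]
    simp [this]
  | succ j ih =>
    push_cast at hku
    have hj : 8 * C * (j * |u|) ≤ 1 := by nlinarith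
    have i4 := ih hj
    have i1 := (abs_cocycle_le hC hg hA hu hj).1
    have o2 := (abs_iterate_sub_le hC hg hu hj).2
    have od := abs_deriv_iterate_le hC hgd hg hg' hu hj
    have hv1 : |g^[j] u| ≤ 1 := by nlinarith
    have hα : Differentiable ℝ (fun v => 1 + v * A v) := by fun_prop
    have hfac := (abs_one_add_le o2 (hA _ hv1)).2
    have hd : deriv (cocycle g A (j + 1)) u =
        deriv (cocycle g A j) u * (1 + g^[j] u * A (g^[j] u)) +
          cocycle g A j u * (deriv (fun v => 1 + v * A v) (g^[j] u) * deriv (g^[j]) u) := by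
      have e : cocycle g A (j + 1) = cocycle g A j * ((fun v => 1 + v * A v) ∘ g^[j]) := by
        funext w; exact cocycle_succ g A j w
      rw [e, deriv_mul (differentiable_cocycle hgd hAd j u)
        ((hα _).comp u (hgd.iterate j u)), deriv_comp u (hα _) (hgd.iterate j u)]
      rfl
    have a' := hA' _ hv1
    set b : ℝ := 1 + 2 * C * |u| with hb
    have hb1 : 1 ≤ b := by
      have : 0 ≤ 2 * C * |u| := by positivity
      linarith
    rw [hd]
    refine (abs_add_le _ _).trans ?_
    rw [abs_mul, abs_mul, abs_mul]
    calc _ ≤ C * j * b ^ (2 * j) * b + b ^ j * (C * b ^ j) := by gcongr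
      _ = C * j * b ^ (2 * j + 1) + C * b ^ (2 * j) := by ring
      _ ≤ C * j * b ^ (2 * (j + 1)) + C * b ^ (2 * (j + 1)) := by
        gcongr <;> first | exact hb1 | lia
      _ = _ := by push_cast; ring

/-- One step of the map `u ↦ u (1 + u A(u)) (1 + u B(u))` governing the product `xy`. -/
def prodMap (A B : ℝ → ℝ) (u : ℝ) : ℝ := u * (1 + u * A u) * (1 + u * B u)

theorem exists_cocycle_bounds {A B : ℝ → ℝ} (hA : ContDiff ℝ (⊤ : ℕ∞) A)
    (hB : ContDiff ℝ (⊤ : ℕ∞) B) (hab : A 0 + B 0 = 0) :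
    ∃ C : ℝ, 1 ≤ C ∧ ∀ (k : ℕ) (u : ℝ), 8 * C * |u| ≤ 1 → 8 * C * (k * |u|) ≤ 1 →
      |(prodMap A B)^[k] u| ≤ 2 * |u| ∧
      (|cocycle (prodMap A B) A k u - 1 - k * A 0 * u| ≤ 20 * C ^ 2 * k ^ 2 * u ^ 2 ∧
        |deriv (cocycle (prodMap A B) A k) u| ≤ 3 * C * k) ∧
      (|cocycle (prodMap A B) B k u - 1 - k * B 0 * u| ≤ 20 * C ^ 2 * k ^ 2 * u ^ 2 ∧
        |deriv (cocycle (prodMap A B) B k) u| ≤ 3 * C * k) := by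
  have hgs : ContDiff ℝ (⊤ : ℕ∞) (prodMap A B) := by unfold prodMap; fun_prop
  have hgd : Differentiable ℝ (prodMap A B) := hgs.differentiable (by simp)
  have hAd : Differentiable ℝ A := hA.differentiable (by simp)
  have hBd : Differentiable ℝ B := hB.differentiable (by simp)
  have hαs : ContDiff ℝ (⊤ : ℕ∞) (fun v => 1 + v * A v) := by fun_prop
  have hβs : ContDiff ℝ (⊤ : ℕ∞) (fun v => 1 + v * B v) := by fun_prop
  have hg's : ContDiff ℝ 1 (deriv (prodMap A B)) :=
    (contDiff_infty_iff_deriv.1 hgs).2.of_le (by exact_mod_cast le_top)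
  have hone : ((1 : ℕ∞) : WithTop ℕ∞) ≤ ((⊤ : ℕ∞) : WithTop ℕ∞) := by exact_mod_cast le_top
  obtain ⟨C1, p1, b1⟩ := exists_abs_le_of_continuous hA.continuous
  obtain ⟨C2, p2, b2⟩ := exists_abs_le_of_continuous hB.continuous
  obtain ⟨C3, p3, b3⟩ := exists_abs_sub_le_of_contDiff (hA.of_le hone)
  obtain ⟨C4, p4, b4⟩ := exists_abs_sub_le_of_contDiff (hB.of_le hone)
  obtain ⟨C5, p5, b5⟩ := exists_abs_le_of_continuous ((hαs.of_le hone).continuous_deriv le_rfl)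
  obtain ⟨C6, p6, b6⟩ := exists_abs_le_of_continuous ((hβs.of_le hone).continuous_deriv le_rfl)
  obtain ⟨C7, p7, b7⟩ := exists_abs_sub_le_of_contDiff hg's
  have hd0 : deriv (prodMap A B) 0 = 1 := by
    have h := (((hasDerivAt_id (0:ℝ)).mul ((hαs.differentiable (by simp)) 0).hasDerivAt).mul
      ((hβs.differentiable (by simp)) 0).hasDerivAt).deriv
    have e : prodMap A B = (id * fun v => 1 + v * A v) * fun v => 1 + v * B v := rfl
    rw [e, h]
    simp
  have h12 := mul_pos p1 p2
  have hg3 : ∀ u, |u| ≤ 1 → |prodMap A B u - u| ≤ (C3 + C4 + C1 * C2) * |u| ^ 3 := by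
    intro u hu
    have e : prodMap A B u - u =
        u ^ 2 * (A u - A 0) + u ^ 2 * (B u - B 0) + u ^ 3 * (A u * B u) := by
      unfold prodMap
      linear_combination u ^ 2 * hab
    rw [e]
    refine (abs_add_le _ _).trans ((add_le_add_left (abs_add_le _ _) _).trans ?_)
    simp only [abs_mul, abs_pow]
    have t1 : |u| ^ 2 * |A u - A 0| ≤ |u| ^ 2 * (C3 * |u|) := by gcongr; exact b3 u hu
    have t2 : |u| ^ 2 * |B u - B 0| ≤ |u| ^ 2 * (C4 * |u|) := by gcongr; exact b4 u hu
    have t3 : |u| ^ 3 * (|A u| * |B u|) ≤ |u| ^ 3 * (C1 * C2) := by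
      gcongr
      exacts [b1 u hu, b2 u hu]
    linarith
  set C := 1 + C1 + C2 + C3 + C4 + C5 + C6 + C7 + C1 * C2 with hC
  have hC1 : 1 ≤ C := by linarith
  have l3 : C3 + C4 + C1 * C2 ≤ C := by linarith
  have l7 : C7 ≤ C := by linarith
  have l3' : C3 ≤ C := by linarith
  have l4' : C4 ≤ C := by linarith
  have hg : ∀ u, |u| ≤ 1 → |prodMap A B u - u| ≤ C * |u| ^ 3 := fun u hu =>
    (hg3 u hu).trans (by gcongr)
  have hg' : ∀ u, |u| ≤ 1 → |deriv (prodMap A B) u - 1| ≤ C * |u| := fun u hu => by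
    have := b7 u hu
    rw [hd0] at this
    exact this.trans (by gcongr)
  refine ⟨C, hC1, fun k u hu hku => ⟨(abs_iterate_sub_le hC1 hg hu hku).2, ?_, ?_⟩⟩
  · have hAC : ∀ u, |u| ≤ 1 → |A u| ≤ C := fun u hu => (b1 u hu).trans (by linarith)
    exact ⟨abs_cocycle_sub_le hC1 hg hAC (fun u hu => (b3 u hu).trans (by gcongr)) hu hku,
      abs_deriv_cocycle_le hC1 hgd hAd hg hg' hAC (fun u hu => (b5 u hu).trans (by linarith)) hu hku⟩
  · have hBC : ∀ u, |u| ≤ 1 → |B u| ≤ C := fun u hu => (b2 u hu).trans (by linarith)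
    exact ⟨abs_cocycle_sub_le hC1 hg hBC (fun u hu => (b4 u hu).trans (by gcongr)) hu hku,
      abs_deriv_cocycle_le hC1 hgd hBd hg hg' hBC (fun u hu => (b6 u hu).trans (by linarith)) hu hku⟩

end CocycleEstimates

section Rescaling

open scoped Topology

variable {E : Type*} [NormedAddCommGroup E] [NormedSpace ℝ E]

theorem C1Lim.hasFDerivAt {Φ : ℕ → E → ℝ} {q : E → ℝ} {M : E → E →L[ℝ] ℝ}
    (h : ∀ p, C1Lim Φ p (q p) (M p)) (hM : Continuous M) (p : E) : HasFDerivAt q (M p) p := by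
  have h₁ : ∀ᶠ r : ℕ × E in atTop ×ˢ 𝓝 p, HasFDerivAt (Φ r.1) (fderiv ℝ (Φ r.1) r.2) r.2 :=
    (h p).differentiable.mono fun r hr => hr.hasFDerivAt
  refine hasFDerivAt_of_tendstoUniformlyOnFilter (l := atTop) (f := Φ)
    (f' := fun k y => fderiv ℝ (Φ k) y) (g' := M) ?_ h₁ (Eventually.of_forall fun y => ?_)
  · rw [Metric.tendstoUniformlyOnFilter_iff]
    intro ε hε
    have h2 : ∀ᶠ r : ℕ × E in atTop ×ˢ 𝓝 p, dist (M r.2) (M p) < ε / 2 :=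
      (hM.tendsto p).comp tendsto_snd |>.eventually (Metric.ball_mem_nhds _ (half_pos hε))
    have h3 := (h p).tendsto_fderiv.eventually (Metric.ball_mem_nhds (M p) (half_pos hε))
    filter_upwards [h2, h3] with r hr hr'
    have := dist_triangle_right (M r.2) (fderiv ℝ (Φ r.1) r.2) (M p)
    linarith
  · exact (h y).tendsto.comp (tendsto_id.prodMk (tendsto_const_nhds (x := y)))

theorem tendsto_base_add_smul {e : ℕ → ℝ} (he : Tendsto e atTop (𝓝 0)) (b p : E) :
    Tendsto (fun r : ℕ × E => b + e r.1 • r.2) (atTop ×ˢ 𝓝 p) (𝓝 b) := by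
  simpa using tendsto_const_nhds.add ((he.comp tendsto_fst).smul (tendsto_snd (g := 𝓝 p)))

theorem hasFDerivAt_base_add_smul (c : ℝ) (b p : E) :
    HasFDerivAt (fun x : E => b + c • x) (c • ContinuousLinearMap.id ℝ E) p :=
  ((hasFDerivAt_id p).const_smul c).const_add b

variable {g : E → ℝ} {e : ℕ → ℝ} {b : E} {L : E →L[ℝ] ℝ}

/-- A first order expansion of a `C¹` function is `C¹`-convergent after rescaling. -/
theorem C1Lim.rescale (hg : ContDiff ℝ 1 g) (he : Tendsto e atTop (𝓝 0)) (he0 : ∀ k, e k ≠ 0)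
    (hq : ∀ p, Tendsto (fun r : ℕ × E => (g (b + e r.1 • r.2) - g b) / e r.1)
      (atTop ×ˢ 𝓝 p) (𝓝 (L p))) :
    fderiv ℝ g b = L ∧ ∀ p, C1Lim (fun k x => (g (b + e k • x) - g b) / e k) p (L p) L := by
  have hd : Differentiable ℝ g := hg.differentiable one_ne_zero
  have key : ∀ p, C1Lim (fun k x => (g (b + e k • x) - g b) / e k) p (L p) (fderiv ℝ g b) := by
    intro p
    refine C1Lim.of_hasFDerivAt (Φ' := fun k x => fderiv ℝ g (b + e k • x)) (hq p)
      (Eventually.of_forall fun r => ?_)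
      (((hg.continuous_fderiv one_ne_zero).tendsto b).comp (tendsto_base_add_smul he b p))
    have h1 := ((((hd (b + e r.1 • r.2)).hasFDerivAt.comp r.2
      (hasFDerivAt_base_add_smul (e r.1) b r.2)).sub_const (g b)).const_smul (e r.1)⁻¹)
    convert h1 using 1
    · funext x; simp [div_eq_inv_mul]
    · ext v; simp [he0 r.1]
  have heq : fderiv ℝ g b = L :=
    (C1Lim.hasFDerivAt key continuous_const 0).unique L.hasFDerivAt
  exact ⟨heq, heq ▸ key⟩

/-- A second order expansion of a `C²` function is `C¹`-convergent after rescaling. -/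
theorem C1Lim.rescale_sq (hg : ContDiff ℝ 2 g) (he : Tendsto e atTop (𝓝 0)) (he0 : ∀ k, e k ≠ 0)
    (hL : fderiv ℝ g b = L) {q : E → ℝ} {q' : E → E →L[ℝ] ℝ}
    (hq' : ∀ p, HasFDerivAt q (q' p) p)
    (hq : ∀ p, Tendsto (fun r : ℕ × E => (g (b + e r.1 • r.2) - g b - e r.1 * L r.2) / e r.1 ^ 2)
      (atTop ×ˢ 𝓝 p) (𝓝 (q p))) (p : E) :
    C1Lim (fun k x => (g (b + e k • x) - g b - e k * L x) / e k ^ 2) p (q p) (q' p) := by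
  have hd : Differentiable ℝ g := hg.differentiable two_ne_zero
  have hd2 : ContDiff ℝ 1 (fderiv ℝ g) := hg.fderiv_right (by norm_num)
  set M := fderiv ℝ (fderiv ℝ g) b with hM
  have hMd : HasFDerivAt (fderiv ℝ g) M b := ((hd2.differentiable one_ne_zero) b).hasFDerivAt
  have key : ∀ p, C1Lim (fun k x => (g (b + e k • x) - g b - e k * L x) / e k ^ 2) p
      (q p) (M p) := by
    intro p
    refine C1Lim.of_hasFDerivAt
      (Φ' := fun k x => (e k)⁻¹ • (fderiv ℝ g (b + e k • x) - L)) (hq p)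
      (Eventually.of_forall fun r => ?_) ?_
    · have h1 := (((((hd (b + e r.1 • r.2)).hasFDerivAt.comp r.2
        (hasFDerivAt_base_add_smul (e r.1) b r.2)).sub_const (g b)).sub
        (L.hasFDerivAt.const_smul (e r.1))).const_smul (e r.1 ^ 2)⁻¹)
      convert h1 using 1
      · funext x; simp [div_eq_inv_mul]
      · ext v
        have := he0 r.1
        simp
        field_simp
    · have ho := hMd.isLittleO.comp_tendsto (tendsto_base_add_smul he b p)
      have hO : (fun r : ℕ × E => e r.1 • r.2) =O[atTop ×ˢ 𝓝 p] fun r => e r.1 := by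
        have hb : Tendsto (fun r : ℕ × E => ‖r.2‖) (atTop ×ˢ 𝓝 p) (𝓝 ‖p‖) :=
          (continuous_norm.tendsto p).comp tendsto_snd
        have := (Asymptotics.isBigO_refl (fun r : ℕ × E => e r.1) (atTop ×ˢ 𝓝 p)).smul
          ((tendsto_snd (f := (atTop : Filter ℕ)) (g := 𝓝 p)).isBigO_one ℝ)
        simpa using this
      have ho' : (fun r : ℕ × E => fderiv ℝ g (b + e r.1 • r.2) - L - M (e r.1 • r.2))
          =o[atTop ×ˢ 𝓝 p] fun r => e r.1 := by
        refine Asymptotics.IsLittleO.trans_isBigO (ho.congr_left ?_) (hO.congr_left ?_)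
        · intro r; simp [hL]
        · intro r; simp
      have ho2 := (Asymptotics.isLittleO_iff_tendsto' (by simp [he0])).1 ho'.norm_left
      have h3 : Tendsto (fun r : ℕ × E => (e r.1)⁻¹ •
          (fderiv ℝ g (b + e r.1 • r.2) - L - M (e r.1 • r.2))) (atTop ×ˢ 𝓝 p) (𝓝 0) := by
        rw [tendsto_zero_iff_norm_tendsto_zero]
        have := ho2.abs
        simpa [norm_smul, div_eq_inv_mul, abs_mul] using this
      have h4 : Tendsto (fun r : ℕ × E => M r.2) (atTop ×ˢ 𝓝 p) (𝓝 (M p)) :=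
        (M.continuous.tendsto p).comp tendsto_snd
      have h5 := h3.add h4
      rw [zero_add] at h5
      refine h5.congr fun r => ?_
      rw [map_smul, smul_sub, smul_smul, inv_mul_cancel₀ (he0 r.1), one_smul, sub_add_cancel]
  have := (C1Lim.hasFDerivAt key M.continuous p).unique (hq' p)
  exact this ▸ key p

/-- The linear form with given coefficients. -/
def lin (a b : ℝ) : ℝ × ℝ →L[ℝ] ℝ :=
  a • ContinuousLinearMap.fst ℝ ℝ ℝ + b • ContinuousLinearMap.snd ℝ ℝ ℝ

@[simp] theorem lin_apply (a b : ℝ) (p : ℝ × ℝ) : lin a b p = a * p.1 + b * p.2 := by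
  simp [lin]

theorem tendsto_of_abs_sub_le {n : ℕ} {φ : ℝ × ℝ → ℝ} {ψ : ℕ → ℝ × ℝ → ℝ} {C ε : ℝ}
    (he : Tendsto e atTop (𝓝 0)) (he0 : ∀ k, e k ≠ 0) (hε : 0 < ε) {p : ℝ × ℝ}
    (hφ : Tendsto φ (𝓝 p) (𝓝 (φ p)))
    (h : ∀ (k : ℕ) (x v : ℝ), |e k * x| < ε → |e k * v| < ε →
      |ψ k (x, v) - e k ^ n * φ (x, v)| ≤ C * (|e k * x| + |e k * v|) ^ (n + 1)) :
    Tendsto (fun r : ℕ × (ℝ × ℝ) => ψ r.1 r.2 / e r.1 ^ n) (atTop ×ˢ 𝓝 p) (𝓝 (φ p)) := by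
  have he' : Tendsto (fun r : ℕ × (ℝ × ℝ) => e r.1) (atTop ×ˢ 𝓝 p) (𝓝 0) := he.comp tendsto_fst
  have h1 : Tendsto (fun r : ℕ × (ℝ × ℝ) => r.2.1) (atTop ×ˢ 𝓝 p) (𝓝 p.1) :=
    (continuous_fst.tendsto p).comp tendsto_snd
  have h2 : Tendsto (fun r : ℕ × (ℝ × ℝ) => r.2.2) (atTop ×ˢ 𝓝 p) (𝓝 p.2) :=
    (continuous_snd.tendsto p).comp tendsto_snd
  have s1 := ((he'.mul h1).abs).eventually_lt_const (u := ε) (by simpa using hε)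
  have s2 := ((he'.mul h2).abs).eventually_lt_const (u := ε) (by simpa using hε)
  have hz : Tendsto (fun r : ℕ × (ℝ × ℝ) => C * (|e r.1| * (|r.2.1| + |r.2.2|) ^ (n + 1)))
      (atTop ×ˢ 𝓝 p) (𝓝 0) := by
    have := (he'.abs.mul ((h1.abs.add h2.abs).pow (n + 1))).const_mul C
    simpa using this
  have hd : Tendsto (fun r : ℕ × (ℝ × ℝ) => ψ r.1 r.2 / e r.1 ^ n - φ r.2)
      (atTop ×ˢ 𝓝 p) (𝓝 0) := by
    refine squeeze_zero_norm' ?_ hz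
    filter_upwards [s1, s2] with r hr1 hr2
    have hb := h r.1 r.2.1 r.2.2 hr1 hr2
    have hpos : 0 < |e r.1| := abs_pos.2 (he0 r.1)
    have e1 : ψ r.1 r.2 / e r.1 ^ n - φ r.2 = (ψ r.1 r.2 - e r.1 ^ n * φ r.2) / e r.1 ^ n := by
      have := he0 r.1
      field_simp
    rw [e1, Real.norm_eq_abs, abs_div, abs_pow, div_le_iff₀ (by positivity)]
    refine hb.trans (le_of_eq ?_)
    rw [abs_mul, abs_mul, ← mul_add, mul_pow]
    ring
  have := hd.add (hφ.comp tendsto_snd)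
  simpa using this

end Rescaling

section TransitionMap

open scoped Topology

variable {T₁ : ℝ × ℝ → ℝ × ℝ} {xs ys c₁ c₂ d₁ d₃ d₄ d₅ : ℝ} {e : ℕ → ℝ}

theorem C1Lim.transition (hT : ContDiff ℝ (⊤ : ℕ∞) T₁)
    (hTay : TaylorExp T₁ xs ys c₁ c₂ d₁ 0 d₃ d₄ d₅) (h0 : T₁ (0, ys) = (xs, 0))
    (he : Tendsto e atTop (𝓝 0)) (he0 : ∀ k, e k ≠ 0) (p : ℝ × ℝ) :
    C1Lim (fun k x => ((T₁ (e k * x.1, ys + e k * x.2)).1 - xs) / e k) p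
        (c₁ * p.1 + c₂ * p.2) (lin c₁ c₂) ∧
    C1Lim (fun k x => ((T₁ (e k * x.1, ys + e k * x.2)).2 - d₁ * (e k * x.1)) / e k ^ 2) p
        (d₃ * p.1 ^ 2 + d₄ * p.1 * p.2 + d₅ * p.2 ^ 2)
        (lin (2 * d₃ * p.1 + d₄ * p.2) (d₄ * p.1 + 2 * d₅ * p.2)) := by
  obtain ⟨C, hC, ε, hε, h⟩ := hTay
  have hone : ((1 : ℕ∞) : WithTop ℕ∞) ≤ ((⊤ : ℕ∞) : WithTop ℕ∞) := by exact_mod_cast le_top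
  have htwo : ((2 : ℕ∞) : WithTop ℕ∞) ≤ ((⊤ : ℕ∞) : WithTop ℕ∞) := by exact_mod_cast le_top
  have g1 : ContDiff ℝ 1 (fun z => (T₁ z).1) := (contDiff_fst.comp hT).of_le hone
  have g2 : ContDiff ℝ 2 (fun z => (T₁ z).2) := (contDiff_snd.comp hT).of_le htwo
  have hb : ∀ (k : ℕ) (x : ℝ × ℝ),
      ((0 : ℝ), ys) + e k • x = (e k * x.1, ys + e k * x.2) := fun k x => by ext <;> simp
  constructor
  · have := (C1Lim.rescale (b := (0, ys)) (L := lin c₁ c₂) g1 he he0 fun p => ?_).2 p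
    · simpa [hb, h0] using this
    · simp only [hb, h0]
      have := tendsto_of_abs_sub_le (n := 1) (φ := lin c₁ c₂) (C := C)
        (ψ := fun k x => (T₁ (e k * x.1, ys + e k * x.2)).1 - xs) he he0 hε
        ((lin c₁ c₂).continuous.tendsto p) fun k x v hx hv => by
          refine le_trans (le_of_eq ?_) (h _ _ hx hv).1
          simp only [lin_apply]
          congr 1
          ring
      simpa using this
  · have hL := (C1Lim.rescale (b := (0, ys)) (L := lin d₁ 0) (g2.of_le one_le_two) he he0
      fun p => ?_).1
    · have := C1Lim.rescale_sq (b := (0, ys)) g2 he he0 hL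
        (q := fun p => d₃ * p.1 ^ 2 + d₄ * p.1 * p.2 + d₅ * p.2 ^ 2)
        (q' := fun p => lin (2 * d₃ * p.1 + d₄ * p.2) (d₄ * p.1 + 2 * d₅ * p.2)) ?_ ?_ p
      · simpa [hb, h0, mul_left_comm] using this
      · intro p
        have f1 : HasFDerivAt (fun p : ℝ × ℝ => p.1) (ContinuousLinearMap.fst ℝ ℝ ℝ) p :=
          hasFDerivAt_fst
        have f2 : HasFDerivAt (fun p : ℝ × ℝ => p.2) (ContinuousLinearMap.snd ℝ ℝ ℝ) p :=
          hasFDerivAt_snd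
        have := (((f1.mul f1).const_mul d₃).add ((f1.const_mul d₄).mul f2)).add
          ((f2.mul f2).const_mul d₅)
        refine (this.congr_of_eventuallyEq (Eventually.of_forall fun x => ?_)).congr_fderiv
          (ContinuousLinearMap.ext fun v => ?_)
        · simp [pow_two]
        simp
        ring
      · intro p
        simp only [hb, h0]
        refine tendsto_of_abs_sub_le (n := 2) (C := C)
          (φ := fun p => d₃ * p.1 ^ 2 + d₄ * p.1 * p.2 + d₅ * p.2 ^ 2)
          (ψ := fun k x => (T₁ (e k * x.1, ys + e k * x.2)).2 - 0 - e k * lin d₁ 0 x) he he0 hε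
          (Continuous.tendsto (by fun_prop) p) fun k x v hx hv => ?_
        refine le_trans (le_of_eq ?_) (h _ _ hx hv).2
        simp only [lin_apply]
        congr 1
        ring
    · simp only [hb, h0]
      have := tendsto_of_abs_sub_le (n := 1) (φ := lin d₁ 0)
        (C := C * ε * 2 + |d₃| + |d₄| + |d₅|)
        (ψ := fun k x => (T₁ (e k * x.1, ys + e k * x.2)).2) he he0 hε
        ((lin d₁ 0).continuous.tendsto p) fun k x v hx hv => by
          have h2 := (h _ _ hx hv).2
          set X := e k * x
          set V := e k * v
          have hX := abs_nonneg X
          have hV := abs_nonneg V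
          have e1 : (T₁ (X, ys + V)).2 - e k ^ 1 * lin d₁ 0 (x, v) =
            ((T₁ (X, ys + V)).2 - (d₁ * X + 0 * V + d₃ * X ^ 2 + d₄ * X * V + d₅ * V ^ 2))
              + d₃ * X ^ 2 + d₄ * (X * V) + d₅ * V ^ 2 := by
            simp only [lin_apply, X]; ring
          have q3 := abs_add_le (((T₁ (X, ys + V)).2 -
            (d₁ * X + 0 * V + d₃ * X ^ 2 + d₄ * X * V + d₅ * V ^ 2)) + d₃ * X ^ 2
              + d₄ * (X * V)) (d₅ * V ^ 2)
          have q2 := abs_add_le (((T₁ (X, ys + V)).2 -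
            (d₁ * X + 0 * V + d₃ * X ^ 2 + d₄ * X * V + d₅ * V ^ 2)) + d₃ * X ^ 2)
              (d₄ * (X * V))
          have q1 := abs_add_le ((T₁ (X, ys + V)).2 -
            (d₁ * X + 0 * V + d₃ * X ^ 2 + d₄ * X * V + d₅ * V ^ 2)) (d₃ * X ^ 2)
          simp only [abs_mul, abs_pow] at q1 q2 q3
          rw [e1]
          set s := |X| + |V| with hs
          have s1 : C * s ^ 3 ≤ C * ε * 2 * s ^ 2 := by
            calc C * s ^ 3 = C * s ^ 2 * s := by ring
              _ ≤ C * s ^ 2 * (2 * ε) := by gcongr; linarith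
              _ = _ := by ring
          have s3 : |d₃| * |X| ^ 2 ≤ |d₃| * s ^ 2 := by gcongr; linarith
          have s5 : |d₅| * |V| ^ 2 ≤ |d₅| * s ^ 2 := by gcongr; linarith
          have s4 : |d₄| * (|X| * |V|) ≤ |d₄| * s ^ 2 := by gcongr; nlinarith
          calc _ ≤ _ := q3
            _ ≤ (C * ε * 2 + |d₃| + |d₄| + |d₅|) * s ^ 2 := by linarith
      simpa using this

end TransitionMap

section LocalPassage

open scoped Topology

theorem C1Lim.cast {E F : Type*} [NormedAddCommGroup E] [NormedSpace ℝ E]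
    [NormedAddCommGroup F] [NormedSpace ℝ F] {Φ Ψ : ℕ → E → F} {p : E} {y z : F}
    {L M : E →L[ℝ] F} (h : C1Lim Φ p y L) (hΨ : ∀ k x, Ψ k x = Φ k x) (hy : z = y) (hL : M = L) :
    C1Lim Ψ p z M := by
  subst hy hL
  exact h.congr (Eventually.of_forall fun r => hΨ r.1 r.2)

theorem C1Lim.remainder {E : Type*} [NormedAddCommGroup E] [NormedSpace ℝ E]
    {R : ℕ → ℝ → ℝ} {C K : ℝ} (hRd : ∀ k, Differentiable ℝ (R k))
    (hR : ∀ (k : ℕ) (u : ℝ), 8 * C * |u| ≤ 1 → 8 * C * (k * |u|) ≤ 1 →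
      |R k u| ≤ K * k ^ 2 * u ^ 2 ∧ |deriv (R k) u| ≤ K * k)
    {e : ℕ → ℝ} (he0 : ∀ k, e k ≠ 0) (he : Tendsto e atTop (𝓝 0))
    (hn : Tendsto (fun k : ℕ => (k : ℝ) * e k) atTop (𝓝 0))
    (hn2 : Tendsto (fun k : ℕ => (k : ℝ) ^ 2 * e k) atTop (𝓝 0))
    {t : ℕ → E → ℝ} {p : E} {t₀ : ℝ} {L : E →L[ℝ] ℝ} (ht : C1Lim t p t₀ L)
    (hτ : C1Lim (fun k x => (k : ℝ) * (t k x - t₀)) p 0 0) :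
    C1Lim (fun k x => R k (e k * t k x) / e k) p 0 0 := by
  have up : ∀ {s : ℕ → ℝ}, Tendsto s atTop (𝓝 0) →
      Tendsto (fun r : ℕ × E => s r.1 * t r.1 r.2) (atTop ×ˢ 𝓝 p) (𝓝 0) := fun hs => by
    simpa using (hs.comp tendsto_fst).mul ht.tendsto
  have s1 : ∀ᶠ r : ℕ × E in atTop ×ˢ 𝓝 p, 8 * C * |e r.1 * t r.1 r.2| ≤ 1 := by
    have := (((up he).abs).const_mul (8 * C)).eventually_lt_const (u := 1) (by simp)
    exact this.mono fun _ h => h.le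
  have s2 : ∀ᶠ r : ℕ × E in atTop ×ˢ 𝓝 p, 8 * C * (r.1 * |e r.1 * t r.1 r.2|) ≤ 1 := by
    have := (((up hn).abs).const_mul (8 * C)).eventually_lt_const (u := 1) (by simp)
    refine this.mono fun r h => ?_
    simpa [abs_mul, mul_assoc] using h.le
  refine C1Lim.of_hasFDerivAt
    (Φ' := fun k x => deriv (R k) (e k * t k x) • fderiv ℝ (t k) x) ?_ ?_ ?_
  · have hz : Tendsto (fun r : ℕ × E => K * (|(r.1 : ℝ) ^ 2 * e r.1| * t r.1 r.2 ^ 2))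
        (atTop ×ˢ 𝓝 p) (𝓝 0) := by
      simpa using (((hn2.abs).comp tendsto_fst).mul (ht.tendsto.pow 2)).const_mul K
    refine squeeze_zero_norm' ?_ hz
    filter_upwards [s1, s2] with r h1 h2
    have hpos : 0 < |e r.1| := abs_pos.2 (he0 r.1)
    rw [Real.norm_eq_abs, abs_div, div_le_iff₀ hpos]
    refine (hR _ _ h1 h2).1.trans (le_of_eq ?_)
    rw [mul_pow, ← sq_abs (e r.1), abs_mul, abs_of_nonneg (by positivity : (0 : ℝ) ≤ (r.1 : ℝ) ^ 2)]
    ring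
  · filter_upwards [ht.differentiable] with r hr
    have h1 := ((hRd r.1 (e r.1 * t r.1 r.2)).hasDerivAt.comp_hasFDerivAt r.2
      (hr.hasFDerivAt.const_mul (e r.1))).mul_const (e r.1)⁻¹
    refine h1.congr_fderiv (ContinuousLinearMap.ext fun v => ?_)
    have := he0 r.1
    simp
    field_simp
  · have hz : Tendsto (fun r : ℕ × E =>
        K * ‖fderiv ℝ (fun x => (r.1 : ℝ) * (t r.1 x - t₀)) r.2‖) (atTop ×ˢ 𝓝 p) (𝓝 0) := by
      simpa using hτ.tendsto_fderiv.norm.const_mul K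
    refine squeeze_zero_norm' ?_ hz
    filter_upwards [s1, s2, ht.differentiable] with r h1 h2 hr
    have h3 : fderiv ℝ (fun x => (r.1 : ℝ) * (t r.1 x - t₀)) r.2
        = (r.1 : ℝ) • fderiv ℝ (t r.1) r.2 :=
      ((hr.hasFDerivAt.sub_const t₀).const_mul (r.1 : ℝ)).fderiv
    rw [h3, norm_smul, norm_smul, Real.norm_eq_abs, Real.norm_natCast, ← mul_assoc]
    gcongr
    exact (hR _ _ h1 h2).2

/-- The correction of the `y`-coordinate of `SR_k`-solutions caused by the resonant terms. -/
def shift (a lam xs ys : ℝ) (k : ℕ) : ℝ := k * a * lam ^ k * xs * ys ^ 2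

/-- First coordinate of the rescaling chart at the homoclinic point `(xs, 0)`. -/
def chartX (lam xs : ℝ) (k : ℕ) (p : ℝ × ℝ) : ℝ := xs + lam ^ k * p.1

/-- Second coordinate of the rescaling chart at `(xs, 0)`, divided by `lam ^ k`. -/
def chartY (a lam xs ys : ℝ) (k : ℕ) (p : ℝ × ℝ) : ℝ :=
  ys + shift a lam xs ys k + lam ^ k * p.2

variable {lam xs ys : ℝ} {A B : ℝ → ℝ}

theorem tendsto_nat_pow_mul_pow (h1 : |lam| < 1) (j : ℕ) :
    Tendsto (fun k : ℕ => (k : ℝ) ^ j * lam ^ k) atTop (𝓝 0) :=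
  tendsto_pow_const_mul_const_pow_of_abs_lt_one j h1

theorem tendsto_shift (a xs ys : ℝ) (h1 : |lam| < 1) :
    Tendsto (shift a lam xs ys) atTop (𝓝 0) := by
  have := ((tendsto_nat_pow_mul_pow h1 1).mul_const (a * xs * ys ^ 2))
  rw [zero_mul] at this
  exact this.congr fun k => by unfold shift; ring

theorem C1Lim.chartX (xs : ℝ) (h1 : |lam| < 1) (p : ℝ × ℝ) :
    C1Lim (chartX lam xs) p xs 0 := by
  have he := tendsto_pow_atTop_nhds_zero_of_abs_lt_one h1
  refine ((C1Lim.const (tendsto_const_nhds (x := xs))).add ((C1Lim.const he).mul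
    (C1Lim.clm (ContinuousLinearMap.fst ℝ ℝ ℝ)))).cast (fun k x => ?_) ?_ ?_
  · simp [_root_.chartX]
  · simp
  · simp

theorem C1Lim.chartY (a xs ys : ℝ) (h1 : |lam| < 1) (p : ℝ × ℝ) :
    C1Lim (chartY a lam xs ys) p ys 0 := by
  have he := tendsto_pow_atTop_nhds_zero_of_abs_lt_one h1
  refine (((C1Lim.const (tendsto_const_nhds (x := ys))).add
    (C1Lim.const (tendsto_shift a xs ys h1))).add ((C1Lim.const he).mul
    (C1Lim.clm (ContinuousLinearMap.snd ℝ ℝ ℝ)))).cast (fun k x => ?_) ?_ ?_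
  · simp [_root_.chartY]
  · simp
  · simp

theorem C1Lim.passage (hlam : lam ≠ 0) (h1 : |lam| < 1) (hxs : xs ≠ 0)
    (hA : ContDiff ℝ (⊤ : ℕ∞) A) (hB : ContDiff ℝ (⊤ : ℕ∞) B) (hab : A 0 + B 0 = 0)
    (p : ℝ × ℝ) :
    C1Lim (fun k x => _root_.chartX lam xs k x * cocycle (prodMap A B) A k
      (lam ^ k * (_root_.chartX lam xs k x * _root_.chartY (A 0) lam xs ys k x))) p xs 0 ∧
    C1Lim (fun k x => (ys / xs * (_root_.chartX lam xs k x * cocycle (prodMap A B) A k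
      (lam ^ k * (_root_.chartX lam xs k x * _root_.chartY (A 0) lam xs ys k x)))
      - ys - shift (A 0) lam xs ys k) / lam ^ k) p (ys / xs * p.1) (lin (ys / xs) 0) ∧
    C1Lim (fun k x => (_root_.chartY (A 0) lam xs ys k x * cocycle (prodMap A B) B k
      (lam ^ k * (_root_.chartX lam xs k x * _root_.chartY (A 0) lam xs ys k x))
      - ys) / lam ^ k) p p.2 (lin 0 1) := by
  obtain ⟨C, hC, hbd⟩ := exists_cocycle_bounds hA hB hab
  have hgd : Differentiable ℝ (prodMap A B) :=
    ContDiff.differentiable (n := (⊤ : ℕ∞)) (by unfold prodMap; fun_prop) (by simp)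
  have hAd : Differentiable ℝ A := hA.differentiable (by simp)
  have hBd : Differentiable ℝ B := hB.differentiable (by simp)
  set a := A 0 with ha
  have hb : B 0 = -a := by linarith
  have he := tendsto_pow_atTop_nhds_zero_of_abs_lt_one h1
  have he0 : ∀ k, lam ^ k ≠ 0 := fun k => pow_ne_zero k hlam
  have hn : Tendsto (fun k : ℕ => (k : ℝ) * lam ^ k) atTop (𝓝 0) := by
    simpa using tendsto_nat_pow_mul_pow h1 1
  have hn2 := tendsto_nat_pow_mul_pow h1 2
  have hks : Tendsto (fun k : ℕ => (k : ℝ) * shift a lam xs ys k) atTop (𝓝 0) := by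
    have := hn2.mul_const (a * xs * ys ^ 2)
    rw [zero_mul] at this
    exact this.congr fun k => by unfold shift; ring
  set x₀ := _root_.chartX lam xs with hx0
  set y₀ := _root_.chartY a lam xs ys with hy0
  have cx : C1Lim x₀ p xs 0 := C1Lim.chartX xs h1 p
  have cy : C1Lim y₀ p ys 0 := C1Lim.chartY a xs ys h1 p
  have cw : C1Lim (fun _ x => x.1) p p.1 (ContinuousLinearMap.fst ℝ ℝ ℝ) :=
    C1Lim.clm (ContinuousLinearMap.fst ℝ ℝ ℝ)
  have cv : C1Lim (fun _ x => x.2) p p.2 (ContinuousLinearMap.snd ℝ ℝ ℝ) :=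
    C1Lim.clm (ContinuousLinearMap.snd ℝ ℝ ℝ)
  have ct : C1Lim (fun k x => x₀ k x * y₀ k x) p (xs * ys) 0 :=
    (cx.mul cy).cast (fun _ _ => rfl) rfl (by simp)
  have cτ : C1Lim (fun k x => (k : ℝ) * (x₀ k x * y₀ k x - xs * ys)) p 0 0 := by
    refine ((((C1Lim.const hn).mul cw).mul cy).add ((C1Lim.const (tendsto_const_nhds (x := xs))).mul
      ((C1Lim.const hks).add ((C1Lim.const hn).mul cv)))).cast (fun k x => ?_) ?_ ?_
    · simp only [hx0, hy0, _root_.chartX, _root_.chartY]; ring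
    · simp
    · simp
  have key : ∀ (D : ℝ → ℝ) (d : ℝ), Differentiable ℝ D → (∀ (k : ℕ) (u : ℝ), 8 * C * |u| ≤ 1 →
      8 * C * (k * |u|) ≤ 1 →
      |cocycle (prodMap A B) D k u - 1 - k * d * u| ≤ 20 * C ^ 2 * k ^ 2 * u ^ 2 ∧
        |deriv (cocycle (prodMap A B) D k) u| ≤ 3 * C * k) →
      C1Lim (fun k x => (cocycle (prodMap A B) D k (lam ^ k * (x₀ k x * y₀ k x)) - 1
        - k * d * (lam ^ k * (x₀ k x * y₀ k x))) / lam ^ k) p 0 0 := by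
    intro D d hD hbd
    have hPd := differentiable_cocycle hgd hD
    refine C1Lim.remainder (R := fun k u => cocycle (prodMap A B) D k u - 1 - k * d * u)
      (C := C) (K := 20 * C ^ 2 + 3 * C + |d|)
      (fun k => ?_) (fun k u hu hku => ⟨?_, ?_⟩) he0 he hn hn2 ct cτ
    · have := hPd k
      fun_prop
    · refine (hbd k u hu hku).1.trans ?_
      gcongr
      have := abs_nonneg d
      linarith
    · have h2 : deriv (fun u => cocycle (prodMap A B) D k u - 1 - k * d * u) u
          = deriv (cocycle (prodMap A B) D k) u - k * d := by
        have := (((hPd k u).hasDerivAt.sub_const 1).sub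
          ((hasDerivAt_id u).const_mul ((k : ℝ) * d))).deriv
        rw [mul_one] at this
        exact this
      rw [h2]
      refine (abs_sub _ _).trans ?_
      rw [abs_mul, Nat.abs_cast]
      have := (hbd k u hu hku).2
      have : (0 : ℝ) ≤ 20 * C ^ 2 * k := by positivity
      linarith
  have cRA := key A a hAd fun k u hu hku => (hbd k u hu hku).2.1
  have cRB := key B (-a) hBd fun k u hu hku => by
    have := (hbd k u hu hku).2.2
    rwa [hb] at this
  have cP : ∀ (D : ℝ → ℝ) (d : ℝ), C1Lim (fun k x =>
      (cocycle (prodMap A B) D k (lam ^ k * (x₀ k x * y₀ k x)) - 1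
        - k * d * (lam ^ k * (x₀ k x * y₀ k x))) / lam ^ k) p 0 0 →
      C1Lim (fun k x => cocycle (prodMap A B) D k (lam ^ k * (x₀ k x * y₀ k x))) p 1 0 := by
    intro D d h
    refine (((C1Lim.const (tendsto_const_nhds (x := (1 : ℝ)))).add
      ((C1Lim.const (hn.mul_const d)).mul ct)).add ((C1Lim.const he).mul h)).cast
      (fun k x => ?_) ?_ ?_
    · have := he0 k
      field_simp
      ring
    · simp
    · simp
  have cPA := cP A a cRA
  have cPB := cP B (-a) cRB
  refine ⟨(cx.mul cPA).cast (fun _ _ => rfl) (by simp) (by simp), ?_, ?_⟩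
  · refine (((C1Lim.const (tendsto_const_nhds (x := ys / xs))).mul (cw.mul cPA)).add
      (((C1Lim.const (tendsto_const_nhds (x := ys))).mul cRA).add
      ((C1Lim.const (tendsto_const_nhds (x := ys * a))).mul cτ))).cast (fun k x => ?_) ?_ ?_
    · have := he0 k
      simp only [hx0, hy0, _root_.chartX, _root_.chartY, shift]
      field_simp
      ring
    · simp
    · ext <;> simp
  · refine ((cv.mul cPB).add ((((C1Lim.const (tendsto_const_nhds (x := ys))).add
      (C1Lim.const (tendsto_shift a xs ys h1))).mul cRB).sub
      (((C1Lim.const (tendsto_const_nhds (x := ys * a))).mul cτ).add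
      ((C1Lim.const (hks.mul_const a)).mul ct)))).cast (fun k x => ?_) ?_ ?_
    · have := he0 k
      simp only [hx0, hy0, _root_.chartX, _root_.chartY, shift]
      field_simp
      ring
    · simp
    · ext <;> simp

end LocalPassage

section LocalOrbit

open scoped Topology

variable {lam xs ys : ℝ} {A B : ℝ → ℝ}

/-- The rescaling chart at the homoclinic point `(xs, 0)`. -/
def chart (a lam xs ys : ℝ) (k : ℕ) (p : ℝ × ℝ) : ℝ × ℝ :=
  (chartX lam xs k p, lam ^ k * chartY a lam xs ys k p)

theorem mul_cocycle_mul_cocycle (A B : ℝ → ℝ) (k : ℕ) (u : ℝ) :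
    u * cocycle (prodMap A B) A k u * cocycle (prodMap A B) B k u = (prodMap A B)^[k] u := by
  induction k with
  | zero => simp [cocycle]
  | succ k ih =>
    rw [Function.iterate_succ_apply', cocycle_succ, cocycle_succ, prodMap, ← ih]
    ring

theorem pow_mul_cocycle_mul_pow_mul_cocycle (A B : ℝ → ℝ) (x y : ℝ) {j k : ℕ} (hj : j ≤ k) :
    lam ^ j * (x * cocycle (prodMap A B) A j (lam ^ k * (x * y))) *
      (lam ^ (k - j) * (y * cocycle (prodMap A B) B j (lam ^ k * (x * y))))
      = (prodMap A B)^[j] (lam ^ k * (x * y)) := by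
  have h : lam ^ k = lam ^ j * lam ^ (k - j) := by rw [← pow_add, Nat.add_sub_cancel' hj]
  rw [← mul_cocycle_mul_cocycle]
  nth_rewrite 3 [h]
  ring

theorem iterate_eq_of_mem {f : ℝ × ℝ → ℝ × ℝ} {N : Set (ℝ × ℝ)} (hlam : lam ≠ 0)
    (hfN : ∀ p ∈ N, f p = (lam * p.1 * (1 + p.1 * p.2 * A (p.1 * p.2)),
       (1 / lam) * p.2 * (1 + p.1 * p.2 * B (p.1 * p.2))))
    {x y : ℝ} {k : ℕ} {P : ℕ → ℝ × ℝ} (hP : ∀ j ≤ k, P j =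
      (lam ^ j * (x * cocycle (prodMap A B) A j (lam ^ k * (x * y))),
        lam ^ (k - j) * (y * cocycle (prodMap A B) B j (lam ^ k * (x * y)))))
    (hN : ∀ j < k, P j ∈ N) {j : ℕ} (hj : j ≤ k) : f^[j] (P 0) = P j := by
  induction j with
  | zero => rfl
  | succ j ih =>
    have hj' : j ≤ k := by omega
    rw [Function.iterate_succ_apply', ih hj', hfN _ (hN j hj), hP _ hj, hP j hj']
    set u := lam ^ k * (x * y) with hu
    have hprod := pow_mul_cocycle_mul_pow_mul_cocycle (lam := lam) A B x y hj'
    rw [← hu] at hprod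
    simp only [hprod, cocycle_succ]
    refine Prod.ext ?_ ?_
    · simp only [pow_succ]; ring
    · simp only
      rw [show k - j = k - (j + 1) + 1 by omega, pow_succ]
      field_simp

theorem exists_cocycle_sub_one_bounds (hA : ContDiff ℝ (⊤ : ℕ∞) A)
    (hB : ContDiff ℝ (⊤ : ℕ∞) B) (hab : A 0 + B 0 = 0) :
    ∃ C : ℝ, 0 < C ∧ ∀ (k : ℕ) (u : ℝ), C * ((k + 1) * |u|) ≤ 1 → ∀ j ≤ k,
      |(prodMap A B)^[j] u| ≤ 2 * |u| ∧
      |cocycle (prodMap A B) A j u - 1| ≤ C * ((k + 1) * |u|) ∧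
      |cocycle (prodMap A B) B j u - 1| ≤ C * ((k + 1) * |u|) := by
  obtain ⟨C, hC, h⟩ := exists_cocycle_bounds hA hB hab
  have hB0 : B 0 = - A 0 := by linarith
  refine ⟨8 * C + 20 * C ^ 2 + |A 0|, by positivity, fun k u hu j hj => ?_⟩
  set s := ((k : ℝ) + 1) * |u| with hs
  have hs0 : 0 ≤ s := by positivity
  have hjs : j * |u| ≤ s := by
    have : (j : ℝ) ≤ k := by exact_mod_cast hj
    rw [hs]; gcongr; linarith
  have hus : |u| ≤ s := by
    rw [hs]; nlinarith [abs_nonneg u, (Nat.cast_nonneg k : (0 : ℝ) ≤ k)]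
  have hA0 := abs_nonneg (A 0)
  have h8 : 8 * C * s ≤ 1 := by nlinarith [mul_nonneg hA0 hs0, mul_nonneg (sq_nonneg C) hs0]
  have hs1 : s ≤ 1 := by nlinarith
  obtain ⟨h1, ⟨h2, -⟩, h3, -⟩ := h j u (le_trans (by gcongr) h8) (le_trans (by gcongr) h8)
  have key : ∀ c d : ℝ, |d| = |A 0| → |c - 1 - j * d * u| ≤ 20 * C ^ 2 * j ^ 2 * u ^ 2 →
      |c - 1| ≤ (8 * C + 20 * C ^ 2 + |A 0|) * s := by
    intro c d hd hc
    have e1 : |c - 1| ≤ |c - 1 - j * d * u| + |j * d * u| := by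
      have := abs_add_le (c - 1 - j * d * u) (j * d * u)
      simpa using this
    have e2 : |j * d * u| = |A 0| * (j * |u|) := by
      rw [abs_mul, abs_mul, hd, Nat.abs_cast]; ring
    have e3 : 20 * C ^ 2 * j ^ 2 * u ^ 2 = 20 * C ^ 2 * (j * |u|) ^ 2 := by
      rw [mul_pow, sq_abs]; ring
    have e4 : (j * |u|) ^ 2 ≤ s := by
      calc (j * |u|) ^ 2 ≤ s ^ 2 := by gcongr
        _ ≤ s := by nlinarith
    calc |c - 1| ≤ 20 * C ^ 2 * s + |A 0| * s := by
          refine e1.trans (add_le_add (hc.trans ?_) ?_)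
          · rw [e3]; gcongr
          · rw [e2]; gcongr
      _ ≤ _ := by nlinarith
  exact ⟨h1, key _ _ rfl h2, key _ _ (by rw [hB0, abs_neg]) h3⟩

theorem exists_forall_near_axes_mem {N : Set (ℝ × ℝ)} (hNopen : IsOpen N) (hNconv : Convex ℝ N)
    (hN0 : ((0 : ℝ), (0 : ℝ)) ∈ N) (h1 : |lam| < 1) (hp1 : ((xs : ℝ), (0 : ℝ)) ∈ N)
    (hp2 : ((lam * xs : ℝ), (0 : ℝ)) ∈ N) (hp3 : ((0 : ℝ), lam * ys) ∈ N)
    (hp4 : ((0 : ℝ), lam ^ 2 * ys) ∈ N) :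
    ∃ r > 0, ∀ z : ℝ × ℝ, (∀ j, dist z (lam ^ j * xs, 0) < r → z ∈ N) ∧
      (∀ i, 1 ≤ i → dist z (0, lam ^ i * ys) < r → z ∈ N) := by
  set s : Set (ℝ × ℝ) := {(0, 0), (xs, 0), (lam * xs, 0), (0, lam * ys), (0, lam ^ 2 * ys)} with hs
  have hfin : s.Finite := by simp [hs]
  have hsub : convexHull ℝ s ⊆ N := by
    refine convexHull_min ?_ hNconv
    intro z hz
    simp only [hs, Set.mem_insert_iff, Set.mem_singleton_iff] at hz
    rcases hz with rfl | rfl | rfl | rfl | rfl <;> assumption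
  obtain ⟨r, hr, hrN⟩ := hfin.isCompact_convexHull (𝕜 := ℝ) |>.exists_thickening_subset_open
    hNopen hsub
  have hmem : ∀ z ∈ s, z ∈ convexHull ℝ s := fun z hz => subset_convexHull ℝ s hz
  have h0 : (0 : ℝ × ℝ) ∈ convexHull ℝ s := hmem (0, 0) (by simp [hs])
  have scale : ∀ (n : ℕ), Even n → ∀ z ∈ s, lam ^ n • z ∈ convexHull ℝ s := fun n hn z hz =>
    (convex_convexHull ℝ s).smul_mem_of_zero_mem h0 (hmem z hz)
      ⟨hn.pow_nonneg _, (le_abs_self _).trans (by rw [abs_pow]; exact pow_le_one₀ (abs_nonneg _) h1.le)⟩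
  have hx : ∀ j, ((lam ^ j * xs, 0) : ℝ × ℝ) ∈ convexHull ℝ s := by
    intro j
    rcases Nat.even_or_odd j with hj | ⟨i, rfl⟩
    · convert scale j hj (xs, 0) (by simp [hs]) using 1
      simp
    · convert scale (2 * i) (by simp) (lam * xs, 0) (by simp [hs]) using 1
      simp [pow_succ, mul_assoc]
  have hy : ∀ i, 1 ≤ i → ((0, lam ^ i * ys) : ℝ × ℝ) ∈ convexHull ℝ s := by
    intro j hj0
    rcases Nat.even_or_odd j with ⟨i, rfl⟩ | ⟨i, rfl⟩
    · obtain ⟨n, rfl⟩ : ∃ n, i = n + 1 := ⟨i - 1, by omega⟩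
      convert scale (2 * n) (by simp) (0, lam ^ 2 * ys) (by simp [hs]) using 1
      refine Prod.ext (by simp) ?_
      simp only [Prod.smul_mk, smul_eq_mul]
      ring
    · convert scale (2 * i) (by simp) (0, lam * ys) (by simp [hs]) using 1
      simp [pow_succ, mul_assoc]
  exact ⟨r, hr, fun z => ⟨fun j hj => hrN (mem_thickening_iff.2 ⟨_, hx j, hj⟩),
    fun i hi hj => hrN (mem_thickening_iff.2 ⟨_, hy i hi, hj⟩)⟩⟩

theorem abs_mul_sub_le {X c x t : ℝ} (hx : 0 ≤ x) (hc : |c - 1| ≤ t) :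
    |X * c - x| ≤ |X - x| * (1 + t) + x * t := by
  have e : X * c - x = (X - x) + (X - x) * (c - 1) + x * (c - 1) := by ring
  rw [e]
  calc _ ≤ |X - x| + |(X - x) * (c - 1)| + |x * (c - 1)| := abs_add_three _ _ _
    _ ≤ |X - x| + |X - x| * t + x * t := by
        rw [abs_mul, abs_mul x, abs_of_nonneg hx]; gcongr
    _ = _ := by ring

/-- For large `k`, the first `k` iterates of a point in the chart follow the normal form, stay in
the domain of the normal form, and do not return to the initial point. -/
theorem eventually_localOrbit {f : ℝ × ℝ → ℝ × ℝ} {N : Set (ℝ × ℝ)} (hlam : lam ≠ 0)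
    (h1 : |lam| < 1) (hxs : 0 < xs) (hys : 0 < ys)
    (hA : ContDiff ℝ (⊤ : ℕ∞) A) (hB : ContDiff ℝ (⊤ : ℕ∞) B) (hab : A 0 + B 0 = 0)
    (hfN : ∀ p ∈ N, f p = (lam * p.1 * (1 + p.1 * p.2 * A (p.1 * p.2)),
       (1 / lam) * p.2 * (1 + p.1 * p.2 * B (p.1 * p.2))))
    {r : ℝ} (hr : 0 < r) (hN : ∀ z : ℝ × ℝ, (∀ j, dist z (lam ^ j * xs, 0) < r → z ∈ N) ∧
      (∀ i, 1 ≤ i → dist z (0, lam ^ i * ys) < r → z ∈ N)) (p : ℝ × ℝ) :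
    ∀ᶠ q : ℕ × (ℝ × ℝ) in atTop ×ˢ 𝓝 p,
      f^[q.1] (chart (A 0) lam xs ys q.1 q.2) = (lam ^ q.1 * (chartX lam xs q.1 q.2 *
        cocycle (prodMap A B) A q.1
          (lam ^ q.1 * (chartX lam xs q.1 q.2 * chartY (A 0) lam xs ys q.1 q.2))),
        chartY (A 0) lam xs ys q.1 q.2 * cocycle (prodMap A B) B q.1
          (lam ^ q.1 * (chartX lam xs q.1 q.2 * chartY (A 0) lam xs ys q.1 q.2))) ∧
      (∀ j < q.1, f^[j] (chart (A 0) lam xs ys q.1 q.2) ∈ Nset N 1) ∧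
      ∀ j, 0 < j → j ≤ q.1 →
        f^[j] (chart (A 0) lam xs ys q.1 q.2) ≠ chart (A 0) lam xs ys q.1 q.2 := by
  obtain ⟨C, hC, hbd⟩ := exists_cocycle_sub_one_bounds hA hB hab
  obtain ⟨δ, hδ, hδr, hδx⟩ : ∃ δ > 0, δ < r ∧ |lam| * (xs + δ) < xs - δ := by
    have hx : 0 < (1 - |lam|) * xs := mul_pos (by linarith) hxs
    refine ⟨min (r / 2) ((1 - |lam|) * xs / 4), by positivity, ?_, ?_⟩
    · exact (min_le_left _ _).trans_lt (by linarith)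
    · have := min_le_right (r / 2) ((1 - |lam|) * xs / 4)
      have hpos : 0 < min (r / 2) ((1 - |lam|) * xs / 4) := by positivity
      nlinarith [abs_nonneg lam]
  have cx := (C1Lim.chartX xs h1 p).tendsto
  have cy := (C1Lim.chartY (A 0) xs ys h1 p).tendsto
  set X : ℕ × (ℝ × ℝ) → ℝ := fun q => chartX lam xs q.1 q.2 with hX
  set Y : ℕ × (ℝ × ℝ) → ℝ := fun q => chartY (A 0) lam xs ys q.1 q.2 with hY
  have he : Tendsto (fun q : ℕ × (ℝ × ℝ) => lam ^ q.1) (atTop ×ˢ 𝓝 p) (𝓝 0) :=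
    (tendsto_pow_atTop_nhds_zero_of_abs_lt_one h1).comp tendsto_fst
  have hke : Tendsto (fun q : ℕ × (ℝ × ℝ) => ((q.1 : ℝ) + 1) * lam ^ q.1) (atTop ×ˢ 𝓝 p) (𝓝 0) := by
    have := ((tendsto_nat_pow_mul_pow h1 1).add
      (tendsto_pow_atTop_nhds_zero_of_abs_lt_one h1)).comp
      (tendsto_fst (f := (atTop : Filter ℕ)) (g := 𝓝 p))
    rw [add_zero] at this
    exact this.congr fun q => by simp only [Function.comp]; ring
  have ht : Tendsto (fun q => C * (((q.1 : ℝ) + 1) * |lam ^ q.1 * (X q * Y q)|))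
      (atTop ×ˢ 𝓝 p) (𝓝 0) := by
    have := ((hke.mul (cx.mul cy)).abs).const_mul C
    rw [zero_mul, abs_zero, mul_zero] at this
    refine this.congr fun q => ?_
    rw [abs_mul, abs_mul, abs_mul (lam ^ q.1), abs_of_nonneg (by positivity : (0 : ℝ) ≤ (q.1 : ℝ) + 1)]
    ring
  have hu : Tendsto (fun q => 2 * |lam ^ q.1 * (X q * Y q)|) (atTop ×ˢ 𝓝 p) (𝓝 0) := by
    simpa using ((he.mul (cx.mul cy)).abs).const_mul 2
  have hdx : Tendsto (fun q => |X q - xs|) (atTop ×ˢ 𝓝 p) (𝓝 0) := by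
    simpa using (cx.sub_const xs).abs
  have hdy : Tendsto (fun q => |Y q - ys|) (atTop ×ˢ 𝓝 p) (𝓝 0) := by
    simpa using (cy.sub_const ys).abs
  have hdX := (hdx.mul (ht.const_add 1)).add (ht.const_mul xs)
  have hdY := (hdy.mul (ht.const_add 1)).add (ht.const_mul ys)
  simp only [zero_mul, mul_zero, add_zero] at hdX hdY
  have hr2 := (he.abs.mul_const ((xs + δ) * (ys + δ)))
  simp only [abs_zero, zero_mul] at hr2
  filter_upwards [ht.eventually_le_const one_pos, hu.eventually_lt_const one_pos,
    hdx.eventually_lt_const hδ, hdX.eventually_lt_const hδ,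
    hdY.eventually_lt_const hδ, hr2.eventually_lt_const (show 0 < r ^ 2 by positivity)] with
    q e1 e2 e3 e4 e5 e6
  have hz : chart (A 0) lam xs ys q.1 q.2 = (X q, lam ^ q.1 * Y q) := rfl
  rw [hz, show chartX lam xs q.1 q.2 = X q from rfl,
    show chartY (A 0) lam xs ys q.1 q.2 = Y q from rfl]
  generalize X q = x at e1 e2 e3 e4 e5 ⊢
  generalize Y q = y at e1 e2 e4 e5 ⊢
  generalize q.1 = k at e1 e2 e4 e5 e6 ⊢
  set u := lam ^ k * (x * y) with hu
  set P : ℕ → ℝ × ℝ := fun j => (lam ^ j * (x * cocycle (prodMap A B) A j u),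
        lam ^ (k - j) * (y * cocycle (prodMap A B) B j u)) with hPdef
  have hb := hbd k u e1
  have ha' : ∀ j ≤ k, |x * cocycle (prodMap A B) A j u - xs| < δ := fun j hj =>
    (abs_mul_sub_le hxs.le (hb j hj).2.1).trans_lt e4
  have hb' : ∀ j ≤ k, |y * cocycle (prodMap A B) B j u - ys| < δ := fun j hj =>
    (abs_mul_sub_le hys.le (hb j hj).2.2).trans_lt e5
  have bd : ∀ {a c : ℝ}, 0 < c → |a - c| < δ → |a| ≤ c + δ := fun {a c} hc h => by
    have := abs_sub_abs_le_abs_sub a c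
    rw [abs_of_pos hc] at this
    linarith
  have hpow : ∀ i : ℕ, |lam ^ i| ≤ 1 := fun i => by
    rw [abs_pow]; exact pow_le_one₀ (abs_nonneg _) h1.le
  have hPN : ∀ j < k, P j ∈ N := by
    intro j hj
    have hsplit : |lam ^ k| = |lam ^ j| * |lam ^ (k - j)| := by
      rw [← abs_mul, ← pow_add]; congr 2; omega
    rcases lt_or_ge (|lam ^ (k - j)| * (ys + δ)) r with hlt | hge
    · refine (hN _).1 j ?_
      rw [hPdef, Prod.dist_eq, max_lt_iff]
      simp only [Real.dist_eq]
      rw [← mul_sub, abs_mul, sub_zero, abs_mul]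
      refine ⟨lt_of_le_of_lt ?_ ((ha' j hj.le).trans hδr), lt_of_le_of_lt ?_ hlt⟩
      · exact mul_le_of_le_one_left (abs_nonneg _) (hpow j)
      · gcongr
        exact bd hys (hb' j hj.le)
    · have hlt : |lam ^ j| * (xs + δ) < r := by
        by_contra! hcon
        have := mul_le_mul hcon hge hr.le (by positivity)
        rw [hsplit] at e6
        nlinarith
      refine (hN _).2 (k - j) (by omega) ?_
      rw [hPdef, Prod.dist_eq, max_lt_iff]
      simp only [Real.dist_eq]
      rw [← mul_sub, abs_mul, sub_zero, abs_mul]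
      refine ⟨lt_of_le_of_lt ?_ hlt, lt_of_le_of_lt ?_ ((hb' j hj.le).trans hδr)⟩
      · gcongr
        exact bd hxs (ha' j hj.le)
      · exact mul_le_of_le_one_left (abs_nonneg _) (hpow _)
  have hit : ∀ j ≤ k, f^[j] (P 0) = P j := fun j hj =>
    iterate_eq_of_mem hlam hfN (fun _ _ => rfl) hPN hj
  have hP0 : (x, lam ^ k * y) = P 0 := by simp [hPdef, cocycle]
  rw [hP0]
  refine ⟨?_, fun j hj => ?_, fun j hj0 hj heq => ?_⟩
  · rw [hit k le_rfl]; simp [hPdef]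
  · rw [hit j hj.le]
    refine ⟨hPN j hj, ?_⟩
    have hprod : (P j).1 * (P j).2 = (prodMap A B)^[j] u :=
      pow_mul_cocycle_mul_pow_mul_cocycle A B x y hj.le
    rw [hprod]
    exact (hb j hj.le).1.trans_lt e2
  · rw [hit j hj] at heq
    have h2 := congrArg Prod.fst heq
    simp only [hPdef, pow_zero, one_mul] at h2
    have h3 : x * cocycle (prodMap A B) A 0 u = x := by simp [cocycle]
    rw [h3] at h2
    have h4 : |x| ≤ |lam| * (xs + δ) := by
      rw [← h2, abs_mul]
      refine mul_le_mul ?_ (bd hxs (ha' j hj)) (abs_nonneg _) (abs_nonneg _)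
      rw [abs_pow]
      exact pow_le_of_le_one (abs_nonneg _) h1.le hj0.ne'
    have h5 := abs_sub_abs_le_abs_sub xs x
    rw [abs_of_pos hxs, abs_sub_comm] at h5
    linarith

end LocalOrbit

section Renormalization

open scoped Topology

variable {lam xs ys : ℝ} {A B : ℝ → ℝ}

theorem ContDiff.iterate_self {E : Type*} [NormedAddCommGroup E] [NormedSpace ℝ E] {f : E → E}
    {n : WithTop ℕ∞} (hf : ContDiff ℝ n f) (m : ℕ) : ContDiff ℝ n f^[m] := by
  induction m with
  | zero => exact contDiff_id
  | succ m ih => rw [Function.iterate_succ']; exact hf.comp ih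

/-- The inverse of `chart`. -/
def chartInv (a lam xs ys : ℝ) (k : ℕ) (z : ℝ × ℝ) : ℝ × ℝ :=
  ((z.1 - xs) / lam ^ k, (z.2 / lam ^ k - ys - shift a lam xs ys k) / lam ^ k)

theorem chart_chartInv (hlam : lam ≠ 0) (a xs ys : ℝ) (k : ℕ) (z : ℝ × ℝ) :
    chart a lam xs ys k (chartInv a lam xs ys k z) = z := by
  have : lam ^ k ≠ 0 := pow_ne_zero k hlam
  refine Prod.ext ?_ ?_ <;> simp only [chart, chartInv, chartX, chartY] <;> field_simp <;> ring

/-- The renormalized return maps converge to a quadratic map. -/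
theorem c1Lim_renormalized {f : ℝ × ℝ → ℝ × ℝ} {c₁ c₂ d₁ d₃ d₄ d₅ : ℝ} {m : ℕ}
    (hf : ContDiff ℝ (⊤ : ℕ∞) f) (hlam : lam ≠ 0) (h1 : |lam| < 1) (hxs : xs ≠ 0)
    (hA : ContDiff ℝ (⊤ : ℕ∞) A) (hB : ContDiff ℝ (⊤ : ℕ∞) B) (hab : A 0 + B 0 = 0)
    (hhom : f^[m] (0, ys) = (xs, 0)) (hTay : TaylorExp (f^[m]) xs ys c₁ c₂ d₁ 0 d₃ d₄ d₅)
    (hd1 : d₁ = ys / xs) {p : ℝ × ℝ}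
    (horb : ∀ᶠ q : ℕ × (ℝ × ℝ) in atTop ×ˢ 𝓝 p,
      f^[q.1] (chart (A 0) lam xs ys q.1 q.2) = (lam ^ q.1 * (chartX lam xs q.1 q.2 *
        cocycle (prodMap A B) A q.1
          (lam ^ q.1 * (chartX lam xs q.1 q.2 * chartY (A 0) lam xs ys q.1 q.2))),
        chartY (A 0) lam xs ys q.1 q.2 * cocycle (prodMap A B) B q.1
          (lam ^ q.1 * (chartX lam xs q.1 q.2 * chartY (A 0) lam xs ys q.1 q.2)))) :
    C1Lim (fun k x => chartInv (A 0) lam xs ys k (f^[k + m] (chart (A 0) lam xs ys k x))) p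
      (c₁ * xs + c₂ * p.2, d₁ * p.1 + (d₃ * xs ^ 2 + d₄ * xs * p.2 + d₅ * p.2 ^ 2))
      ((lin 0 c₂).prod (lin d₁ (d₄ * xs + 2 * d₅ * p.2))) := by
  subst hd1
  have he0 : ∀ k, lam ^ k ≠ 0 := fun k => pow_ne_zero k hlam
  obtain ⟨hX, hY, hV⟩ := C1Lim.passage (ys := ys) hlam h1 hxs hA hB hab p
  obtain ⟨t1, t2⟩ := C1Lim.transition (hf.iterate_self m) hTay hhom
    (tendsto_pow_atTop_nhds_zero_of_abs_lt_one h1) he0 (xs, p.2)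
  have hXV := hX.prodMk hV
  refine (((t1.comp hXV).prodMk (hY.add (t2.comp hXV))).cast (fun _ _ => rfl) rfl rfl).congr ?_
    |>.cast (fun _ _ => rfl) rfl ?_
  · filter_upwards [horb] with q hq
    have := he0 q.1
    rw [add_comm q.1 m, Function.iterate_add_apply, hq, chartInv]
    rw [mul_div_cancel₀ _ this, add_sub_cancel]
    refine Prod.ext rfl ?_
    simp only
    field_simp
    ring
  · refine ContinuousLinearMap.ext fun v => Prod.ext ?_ ?_ <;> simp

end Renormalization

section Stability

open scoped Topology

theorem exists_infDist_lt_imp {X : Type*} [PseudoMetricSpace X] {s : Set X} (hs : IsCompact s)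
    (hne : s.Nonempty) {P : X → Prop} (h : ∀ x ∈ s, ∀ᶠ q in 𝓝 x, P q) :
    ∃ δ > 0, ∀ q, infDist q s < δ → P q := by
  obtain ⟨δ, hδ, hsub⟩ := hs.exists_thickening_subset_open
    (isOpen_setOfPred_eventually_nhds (p := P)) h
  refine ⟨δ, hδ, fun q hq => ?_⟩
  obtain ⟨y, hy, hqy⟩ := (infDist_lt_iff hne).1 hq
  exact (hsub (mem_thickening_iff.2 ⟨y, hy, hqy⟩)).self_of_nhds

variable {f : ℝ × ℝ → ℝ × ℝ} {p : ℝ × ℝ} {n : ℕ}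

theorem mem_orbit (f : ℝ × ℝ → ℝ × ℝ) (p : ℝ × ℝ) (j : ℕ) : f^[j] p ∈ orbit f p := ⟨j, rfl⟩

theorem orbit_eq_image (hn : 0 < n) (hp : f^[n] p = p) :
    orbit f p = (fun j => f^[j] p) '' Set.Iio n := by
  refine Set.Subset.antisymm ?_ (Set.image_subset_range _ _)
  rintro _ ⟨j, rfl⟩
  exact ⟨j % n, Nat.mod_lt _ hn, Function.IsPeriodicPt.iterate_mod_apply hp j⟩

/-- A periodic orbit is asymptotically stable if some return map contracts towards a point
of the orbit. -/
theorem asympStable_of_contracting (hf : Continuous f) (hn : 0 < n) (hp : f^[n] p = p) {c : ℝ}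
    (hc0 : 0 ≤ c) (hc : c < 1) (h : ∀ᶠ q in 𝓝 p, dist (f^[n] q) p ≤ c * dist q p) :
    AsympStable f p := by
  obtain ⟨ρ, hρ, hcon⟩ := Metric.eventually_nhds_iff.1 h
  have hpow : ∀ q, dist q p < ρ → ∀ i : ℕ, dist (f^[n * i] q) p ≤ c ^ i * dist q p := by
    intro q hq i
    induction i with
    | zero => simp
    | succ i ih =>
      have hlt : dist (f^[n * i] q) p < ρ := (ih.trans (mul_le_of_le_one_left dist_nonneg
        (pow_le_one₀ hc0 hc.le))).trans_lt hq
      rw [Nat.mul_succ, add_comm, Function.iterate_add_apply]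
      calc _ ≤ c * dist (f^[n * i] q) p := hcon hlt
        _ ≤ c * (c ^ i * dist q p) := by gcongr
        _ = _ := by ring
  have hnear : ∀ ε > 0, ∀ s r : ℕ, ∀ᶠ q in 𝓝 (f^[s] p), infDist (f^[r] q) (orbit f p) < ε := by
    intro ε hε s r
    have hcts : Continuous fun q => infDist (f^[r] q) (orbit f p) :=
      (continuous_infDist_pt _).comp (hf.iterate r)
    refine (hcts.tendsto (f^[s] p)).eventually_lt_const ?_
    rw [← Function.iterate_add_apply, infDist_zero_of_mem (mem_orbit f p _)]
    exact hε
  have hstab : ∀ ε > 0, ∃ δ > 0, ∀ q, dist q p < δ → ∀ j, infDist (f^[j] q) (orbit f p) < ε := by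
    intro ε hε
    have h1 : ∀ᶠ q in 𝓝 p, ∀ r < n, infDist (f^[r] q) (orbit f p) < ε := by
      have := (Finset.eventually_all (Finset.range n)).2 fun r _ => hnear ε hε 0 r
      simpa using this
    obtain ⟨δ, hδ, h2⟩ := Metric.eventually_nhds_iff.1 h1
    refine ⟨min δ ρ, lt_min hδ hρ, fun q hq j => ?_⟩
    obtain ⟨hq1, hq2⟩ := lt_min_iff.1 hq
    rw [← Nat.mod_add_div j n, Function.iterate_add_apply]
    refine h2 (lt_of_le_of_lt ((hpow q hq2 _).trans ?_) hq1) _ (Nat.mod_lt _ hn)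
    exact mul_le_of_le_one_left dist_nonneg (pow_le_one₀ hc0 hc.le)
  have hattr : ∀ q, dist q p < ρ →
      Tendsto (fun j => infDist (f^[j] q) (orbit f p)) atTop (𝓝 0) := by
    intro q hq
    refine Metric.tendsto_atTop.2 fun ε hε => ?_
    obtain ⟨δ, hδ, h2⟩ := hstab ε hε
    have hlim : Tendsto (fun i : ℕ => c ^ i * dist q p) atTop (𝓝 0) := by
      simpa using (tendsto_pow_atTop_nhds_zero_of_lt_one hc0 hc).mul_const (dist q p)
    obtain ⟨i, hi⟩ := (hlim.eventually_lt_const hδ).exists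
    refine ⟨n * i, fun j hj => ?_⟩
    obtain ⟨l, rfl⟩ := Nat.exists_eq_add_of_le' hj
    rw [Real.dist_0_eq_abs, abs_of_nonneg infDist_nonneg, Function.iterate_add_apply]
    exact h2 _ ((hpow q hq i).trans_lt hi) l
  have hreturn : ∀ s < n, Tendsto f^[n - s] (𝓝 (f^[s] p)) (𝓝 p) := by
    intro s hs
    have := (hf.iterate (n - s)).tendsto (f^[s] p)
    rwa [← Function.iterate_add_apply, Nat.sub_add_cancel hs.le, hp] at this
  have hcpt : IsCompact (orbit f p) := by
    rw [orbit_eq_image hn hp]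
    exact ((Set.finite_Iio n).image _).isCompact
  have hne : (orbit f p).Nonempty := ⟨_, mem_orbit f p 0⟩
  refine ⟨fun ε hε => exists_infDist_lt_imp hcpt hne ?_, exists_infDist_lt_imp hcpt hne ?_⟩
  · rw [orbit_eq_image hn hp]
    rintro _ ⟨s, hs, rfl⟩
    rw [← orbit_eq_image hn hp]
    obtain ⟨δ, hδ, h2⟩ := hstab ε hε
    have h1 : ∀ᶠ q in 𝓝 (f^[s] p), ∀ r < n - s, infDist (f^[r] q) (orbit f p) < ε := by
      have := (Finset.eventually_all (Finset.range (n - s))).2 fun r _ => hnear ε hε s r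
      simpa using this
    filter_upwards [h1, (hreturn s hs).eventually (Metric.ball_mem_nhds p hδ)] with q hq hq' j
    rcases lt_or_ge j (n - s) with hj | hj
    · exact hq j hj
    · obtain ⟨l, rfl⟩ := Nat.exists_eq_add_of_le' hj
      rw [Function.iterate_add_apply]
      exact h2 _ hq' l
  · rw [orbit_eq_image hn hp]
    rintro _ ⟨s, hs, rfl⟩
    rw [← orbit_eq_image hn hp]
    filter_upwards [(hreturn s hs).eventually (Metric.ball_mem_nhds p hρ)] with q hq
    refine (tendsto_add_atTop_iff_nat (n - s)).1 ?_
    simp only [Function.iterate_add_apply]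
    exact hattr _ hq

theorem asympStable_of_norm_pow_lt_one (hf : Continuous f) (hn : 0 < n) (hp : f^[n] p = p)
    {L : ℝ × ℝ →L[ℝ] ℝ × ℝ} (hL : HasFDerivAt f^[n] L p) {i : ℕ} (hi : 0 < i)
    (h : ‖L ^ i‖ < 1) : AsympStable f p := by
  have hd : HasFDerivAt f^[n * i] (L ^ i) p := by
    rw [Function.iterate_mul]
    exact hL.iterate hp i
  have hp' : f^[n * i] p = p := by
    rw [Function.iterate_mul]
    exact Function.iterate_fixed hp i
  obtain ⟨c, hc, hc1⟩ := exists_between h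
  have hc0 : 0 ≤ c := (norm_nonneg _).trans hc.le
  refine asympStable_of_contracting hf (Nat.mul_pos hn hi) hp' hc0 hc1 ?_
  filter_upwards [hd.isLittleO.def (sub_pos.2 hc)] with q hq
  rw [hp'] at hq
  rw [dist_eq_norm, dist_eq_norm]
  calc ‖f^[n * i] q - p‖ = ‖(f^[n * i] q - p - (L ^ i) (q - p)) + (L ^ i) (q - p)‖ := by
        rw [sub_add_cancel]
    _ ≤ (c - ‖L ^ i‖) * ‖q - p‖ + ‖L ^ i‖ * ‖q - p‖ :=
        (norm_add_le _ _).trans (add_le_add hq ((L ^ i).le_opNorm _))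
    _ = _ := by ring

/-- Powers of a root of a quadratic polynomial satisfying the Jury conditions are bounded. -/
theorem exists_norm_pow_succ_le {R : Type*} [NormedRing R] [NormedAlgebra ℝ R] {M : R} {τ D : ℝ}
    (hM : M ^ 2 = τ • M - D • (1 : R)) (hD : D ≤ 1) (hτ : |τ| < 1 + D) :
    ∃ K, ∀ j : ℕ, ‖M ^ (j + 1)‖ ≤ K := by
  set κ := (1 + D) / (1 + D - |τ|) with hκ
  have hpos : 0 < 1 + D - |τ| := by linarith
  have key : ∀ j : ℕ, ∃ a b : ℝ, M ^ (j + 1) = a • M - (D * b) • (1 : R) ∧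
      (1 + D) * (a ^ 2 + b ^ 2) - 2 * τ * (a * b) ≤ 1 + D := by
    intro j
    induction j with
    | zero => exact ⟨1, 0, by simp, by simp⟩
    | succ j ih =>
      obtain ⟨a, b, hab, hQ⟩ := ih
      refine ⟨τ * a - D * b, a, ?_, ?_⟩
      · rw [pow_succ, hab, sub_mul, smul_mul_assoc, smul_mul_assoc, one_mul, ← sq, hM]
        module
      · nlinarith [mul_nonneg (sub_nonneg.2 hD) (sq_nonneg (τ * a - (1 + D) * b))]
  refine ⟨(1 + κ) * ‖M‖ + |D| * (1 + κ) * ‖(1 : R)‖, fun j => ?_⟩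
  obtain ⟨a, b, hab, hQ⟩ := key j
  have hs : a ^ 2 + b ^ 2 ≤ κ := by
    rw [hκ, le_div_iff₀ hpos]
    have h2 : 2 * τ * (a * b) ≤ |τ| * (a ^ 2 + b ^ 2) := by
      have h3 : 2 * (a * b) ≤ a ^ 2 + b ^ 2 := by nlinarith [sq_nonneg (a - b)]
      have h4 : -(2 * (a * b)) ≤ a ^ 2 + b ^ 2 := by nlinarith [sq_nonneg (a + b)]
      calc 2 * τ * (a * b) ≤ |τ * (2 * (a * b))| := by
            refine le_trans (le_of_eq (by ring)) (le_abs_self _)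
        _ = |τ| * |2 * (a * b)| := abs_mul _ _
        _ ≤ _ := by gcongr; exact abs_le'.2 ⟨h3, h4⟩
    nlinarith
  have ha : |a| ≤ 1 + κ := by nlinarith [sq_abs a, sq_nonneg b, sq_nonneg (|a| - 1)]
  have hb : |b| ≤ 1 + κ := by nlinarith [sq_abs b, sq_nonneg a, sq_nonneg (|b| - 1)]
  rw [hab]
  refine (norm_sub_le _ _).trans (add_le_add ?_ ?_)
  · rw [norm_smul, Real.norm_eq_abs]; gcongr
  · rw [norm_smul, Real.norm_eq_abs, abs_mul]; gcongr

theorem exists_norm_pow_lt_one {R : Type*} [NormedRing R] [NormedAlgebra ℝ R] {M : R} {τ D : ℝ}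
    (hM : M ^ 2 = τ • M - D • (1 : R)) (hD : D < 1) (hτ : |τ| < 1 + D) :
    ∃ i : ℕ, 0 < i ∧ ‖M ^ i‖ < 1 := by
  obtain ⟨r, ⟨hr0, hr1⟩, hrD, hrτ⟩ :
      ∃ r : ℝ, (0 < r ∧ r < 1) ∧ D < r ^ 2 ∧ |τ| * r < r ^ 2 + D := by
    have e1 : ∀ᶠ r : ℝ in 𝓝 1, D < r ^ 2 :=
      (Continuous.tendsto' (by fun_prop) 1 1 (by norm_num)).eventually_const_lt hD
    have e2 : ∀ᶠ r : ℝ in 𝓝 1, 0 < r ^ 2 + D - |τ| * r :=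
      (Continuous.tendsto' (by fun_prop) 1 (1 + D - |τ|) (by ring)).eventually_const_lt
        (by linarith)
    have e3 : ∀ᶠ r : ℝ in 𝓝[<] 1, 0 < r ∧ r < 1 := Ioo_mem_nhdsLT one_pos
    obtain ⟨r, h3, h1, h2⟩ := (e3.and ((e1.and e2).filter_mono nhdsWithin_le_nhds)).exists
    exact ⟨r, h3, h1, by linarith⟩
  have hL : (r⁻¹ • M) ^ 2 = (τ / r) • (r⁻¹ • M) - (D / r ^ 2) • (1 : R) := by
    rw [smul_pow, hM, smul_sub, smul_smul, smul_smul, smul_smul]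
    congr 2 <;> field_simp
  obtain ⟨K, hK⟩ := exists_norm_pow_succ_le hL
    (by rw [div_le_one (by positivity)]; exact hrD.le) (by
      rw [abs_div, abs_of_pos hr0, div_lt_iff₀ hr0]
      have : (1 + D / r ^ 2) * r * r = r ^ 2 + D := by field_simp
      nlinarith)
  have hlim : Tendsto (fun j : ℕ => r ^ (j + 1) * K) atTop (𝓝 0) := by
    simpa using (((tendsto_pow_atTop_nhds_zero_of_lt_one hr0.le hr1).comp
      (tendsto_add_atTop_nat 1)).mul_const K)
  obtain ⟨j, hj⟩ := (hlim.eventually_lt_const one_pos).exists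
  refine ⟨j + 1, j.succ_pos, lt_of_le_of_lt ?_ hj⟩
  have : M ^ (j + 1) = r ^ (j + 1) • (r⁻¹ • M) ^ (j + 1) := by
    rw [← smul_pow, smul_smul, mul_inv_cancel₀ hr0.ne', one_smul]
  rw [this, norm_smul, Real.norm_eq_abs, abs_of_pos (pow_pos hr0 _)]
  gcongr
  exact hK j

end Stability

section PlanarLinear

open scoped Topology

/-- The trace of a linear map of the plane. -/
def planeTrace (L : ℝ × ℝ →L[ℝ] ℝ × ℝ) : ℝ := (L (1, 0)).1 + (L (0, 1)).2

/-- The determinant of a linear map of the plane. -/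
def planeDet (L : ℝ × ℝ →L[ℝ] ℝ × ℝ) : ℝ :=
  (L (1, 0)).1 * (L (0, 1)).2 - (L (0, 1)).1 * (L (1, 0)).2

theorem continuous_planeTrace : Continuous planeTrace := by unfold planeTrace; fun_prop

theorem continuous_planeDet : Continuous planeDet := by unfold planeDet; fun_prop

theorem apply_eq_planar (L : ℝ × ℝ →L[ℝ] ℝ × ℝ) (v : ℝ × ℝ) :
    L v = ((L (1, 0)).1 * v.1 + (L (0, 1)).1 * v.2, (L (1, 0)).2 * v.1 + (L (0, 1)).2 * v.2) := by
  have h : v = v.1 • ((1 : ℝ), (0 : ℝ)) + v.2 • ((0 : ℝ), (1 : ℝ)) := by ext <;> simp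
  conv_lhs => rw [h, map_add, map_smul, map_smul]
  ext <;> simp <;> ring

theorem sq_eq_planeTrace_smul_sub (L : ℝ × ℝ →L[ℝ] ℝ × ℝ) :
    L ^ 2 = planeTrace L • L - planeDet L • (1 : ℝ × ℝ →L[ℝ] ℝ × ℝ) := by
  refine ContinuousLinearMap.ext fun v => ?_
  rw [sq, mul_apply_eq_comp, apply_eq_planar L (L v), apply_eq_planar L v]
  simp only [sub_apply, smul_apply,
    one_apply_eq_self, planeTrace, planeDet]
  rw [apply_eq_planar L v]
  ext <;> simp <;> ring

theorem jac_eq_of_hasFDerivAt {T : ℝ × ℝ → ℝ × ℝ} {z : ℝ × ℝ} {L : ℝ × ℝ →L[ℝ] ℝ × ℝ}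
    (h : HasFDerivAt T L z) :
    jac T z = !![(L (1, 0)).1, (L (0, 1)).1; (L (1, 0)).2, (L (0, 1)).2] := by
  simp [jac, h.fst.fderiv, h.snd.fderiv]

theorem trace_jac {T : ℝ × ℝ → ℝ × ℝ} {z : ℝ × ℝ} {L : ℝ × ℝ →L[ℝ] ℝ × ℝ}
    (h : HasFDerivAt T L z) : (jac T z).trace = planeTrace L := by
  simp [jac_eq_of_hasFDerivAt h, Matrix.trace_fin_two, planeTrace]

theorem det_jac {T : ℝ × ℝ → ℝ × ℝ} {z : ℝ × ℝ} {L : ℝ × ℝ →L[ℝ] ℝ × ℝ}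
    (h : HasFDerivAt T L z) : (jac T z).det = planeDet L := by
  simp [jac_eq_of_hasFDerivAt h, Matrix.det_fin_two, planeDet]

/-- The linear isomorphism of the plane with an invertible matrix. -/
def planeEquiv (L : ℝ × ℝ →L[ℝ] ℝ × ℝ) (h : planeDet L ≠ 0) : (ℝ × ℝ) ≃L[ℝ] ℝ × ℝ :=
  ContinuousLinearEquiv.equivOfInverse L
    ((planeDet L)⁻¹ • (planeTrace L • (1 : ℝ × ℝ →L[ℝ] ℝ × ℝ) - L))
    (fun v => by
      have e := congrArg (fun M : ℝ × ℝ →L[ℝ] ℝ × ℝ => M v) (sq_eq_planeTrace_smul_sub L)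
      simp only [sq, mul_apply_eq_comp, sub_apply,
        smul_apply, one_apply_eq_self] at e ⊢
      rw [e, sub_sub_cancel, smul_smul, inv_mul_cancel₀ h, one_smul])
    (fun v => by
      have e := congrArg (fun M : ℝ × ℝ →L[ℝ] ℝ × ℝ => M v) (sq_eq_planeTrace_smul_sub L)
      simp only [sq, mul_apply_eq_comp, sub_apply,
        smul_apply, one_apply_eq_self, map_smul, map_sub] at e ⊢
      rw [e, sub_sub_cancel, smul_smul, inv_mul_cancel₀ h, one_smul])

theorem coe_planeEquiv (L : ℝ × ℝ →L[ℝ] ℝ × ℝ) (h : planeDet L ≠ 0) :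
    (planeEquiv L h : ℝ × ℝ →L[ℝ] ℝ × ℝ) = L := rfl

theorem planeDet_sub_one (L : ℝ × ℝ →L[ℝ] ℝ × ℝ) :
    planeDet (L - 1) = 1 - planeTrace L + planeDet L := by
  simp [planeDet, planeTrace]; ring

theorem isSaddle_of_planeTrace {f : ℝ × ℝ → ℝ × ℝ} {n : ℕ} {p : ℝ × ℝ} {L : ℝ × ℝ →L[ℝ] ℝ × ℝ}
    (hL : HasFDerivAt f^[n] L p) (h1 : 1 - planeTrace L + planeDet L < 0)
    (h2 : 0 < 1 + planeTrace L + planeDet L) : IsSaddle f n p := by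
  set τ := planeTrace L with hτ
  set D := planeDet L with hD
  have hdisc : |2 + 2 * D| < 2 * τ := abs_lt.2 ⟨by linarith, by linarith⟩
  have hτ0 : 0 < τ := by linarith [abs_nonneg (2 + 2 * D)]
  set s := Real.sqrt (τ ^ 2 - 4 * D) with hs
  have hlow : (|2 - τ|) ^ 2 < τ ^ 2 - 4 * D := by rw [sq_abs]; nlinarith
  have hss : s ^ 2 = τ ^ 2 - 4 * D := Real.sq_sqrt (by nlinarith [sq_nonneg |2 - τ|])
  have hs0 : 0 ≤ s := Real.sqrt_nonneg _
  have hlt1 : |2 - τ| < s := Real.lt_sqrt_of_sq_lt hlow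
  have hlt2 : s < τ + 2 := by
    rw [hs, Real.sqrt_lt' (by linarith)]; nlinarith
  obtain ⟨ha, hb⟩ := abs_lt.1 hlt1
  refine ⟨(τ - s) / 2, (τ + s) / 2, ?_, ?_, ?_, ?_⟩
  · rw [trace_jac hL]; ring
  · rw [det_jac hL]; nlinarith
  · exact abs_lt.2 ⟨by linarith, by linarith⟩
  · exact lt_of_lt_of_le (by linarith) (le_abs_self _)

theorem asympStable_of_planeTrace {f : ℝ × ℝ → ℝ × ℝ} {n : ℕ} {p : ℝ × ℝ}
    {L : ℝ × ℝ →L[ℝ] ℝ × ℝ} (hf : Continuous f) (hn : 0 < n) (hp : f^[n] p = p)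
    (hL : HasFDerivAt f^[n] L p) (hD : planeDet L < 1) (hτ : |planeTrace L| < 1 + planeDet L) :
    AsympStable f p := by
  obtain ⟨i, hi, h⟩ := exists_norm_pow_lt_one (sq_eq_planeTrace_smul_sub L) hD hτ
  exact asympStable_of_norm_pow_lt_one hf hn hp hL hi h

end PlanarLinear

section PeriodicSolutions

open scoped Topology

variable {lam xs ys : ℝ} {A B : ℝ → ℝ}

theorem hasFDerivAt_chart (a lam xs ys : ℝ) (k : ℕ) (p : ℝ × ℝ) :
    HasFDerivAt (chart a lam xs ys k) ((lin (lam ^ k) 0).prod (lin 0 (lam ^ k * lam ^ k))) p := by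
  have h1 := ((hasFDerivAt_fst (𝕜 := ℝ) (p := p)).const_mul (lam ^ k)).const_add xs
  have h2 := (((hasFDerivAt_snd (𝕜 := ℝ) (p := p)).const_mul (lam ^ k)).const_add
    (ys + shift a lam xs ys k)).const_mul (lam ^ k)
  refine (h1.prodMk h2).congr_fderiv (ContinuousLinearMap.ext fun v => ?_)
  ext <;> simp [mul_assoc]

theorem hasFDerivAt_chartInv (a lam xs ys : ℝ) (k : ℕ) (z : ℝ × ℝ) :
    HasFDerivAt (chartInv a lam xs ys k)
      ((lin (lam ^ k)⁻¹ 0).prod (lin 0 ((lam ^ k)⁻¹ * (lam ^ k)⁻¹))) z := by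
  have h1 := ((hasFDerivAt_fst (𝕜 := ℝ) (p := z)).sub_const xs).mul_const (lam ^ k)⁻¹
  have h2 := ((((hasFDerivAt_snd (𝕜 := ℝ) (p := z)).mul_const (lam ^ k)⁻¹).sub_const ys).sub_const
    (shift a lam xs ys k)).mul_const (lam ^ k)⁻¹
  refine (h1.prodMk h2).congr_fderiv (ContinuousLinearMap.ext fun v => ?_)
  ext <;> simp [mul_assoc]

theorem hasFDerivAt_conj {F : ℝ × ℝ → ℝ × ℝ} (hF : Differentiable ℝ F) (hlam : lam ≠ 0)
    (a xs ys : ℝ) (k : ℕ) (p : ℝ × ℝ) :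
    ∃ L, HasFDerivAt (fun x => chartInv a lam xs ys k (F (chart a lam xs ys k x))) L p ∧
      planeTrace L = planeTrace (fderiv ℝ F (chart a lam xs ys k p)) ∧
      planeDet L = planeDet (fderiv ℝ F (chart a lam xs ys k p)) := by
  have he : lam ^ k ≠ 0 := pow_ne_zero k hlam
  refine ⟨_, (hasFDerivAt_chartInv a lam xs ys k _).comp p
    ((hF (chart a lam xs ys k p)).hasFDerivAt.comp p (hasFDerivAt_chart a lam xs ys k p)), ?_, ?_⟩
  · simp only [planeTrace, ContinuousLinearMap.comp_apply, ContinuousLinearMap.prod_apply, lin_apply]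
    rw [apply_eq_planar (fderiv ℝ F (chart a lam xs ys k p)) (_, _),
      apply_eq_planar (fderiv ℝ F (chart a lam xs ys k p)) (lam ^ k * (0, 1).1 + _, _)]
    simp
    field_simp
  · simp only [planeDet, ContinuousLinearMap.comp_apply, ContinuousLinearMap.prod_apply, lin_apply]
    rw [apply_eq_planar (fderiv ℝ F (chart a lam xs ys k p)) (_, _),
      apply_eq_planar (fderiv ℝ F (chart a lam xs ys k p)) (lam ^ k * (0, 1).1 + _, _)]
    simp
    field_simp

/-- A nondegenerate fixed point of the limit of the renormalized return maps gives rise to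
`SR_k`-solutions for all large `k`, whose multipliers are close to those of the fixed point. -/
theorem eventually_exists_isSRSol {f : ℝ × ℝ → ℝ × ℝ} {c₁ c₂ d₁ d₃ d₄ d₅ r : ℝ} {m : ℕ}
    {N : Set (ℝ × ℝ)} (hf : ContDiff ℝ (⊤ : ℕ∞) f) (hlam : lam ≠ 0) (h1 : |lam| < 1)
    (hxs : 0 < xs) (hys : 0 < ys)
    (hA : ContDiff ℝ (⊤ : ℕ∞) A) (hB : ContDiff ℝ (⊤ : ℕ∞) B) (hab : A 0 + B 0 = 0)
    (hfN : ∀ p ∈ N, f p = (lam * p.1 * (1 + p.1 * p.2 * A (p.1 * p.2)),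
       (1 / lam) * p.2 * (1 + p.1 * p.2 * B (p.1 * p.2))))
    (hr : 0 < r) (hN : ∀ z : ℝ × ℝ, (∀ j, dist z (lam ^ j * xs, 0) < r → z ∈ N) ∧
      (∀ i, 1 ≤ i → dist z (0, lam ^ i * ys) < r → z ∈ N))
    (hhom : f^[m] (0, ys) = (xs, 0)) (hTay : TaylorExp (f^[m]) xs ys c₁ c₂ d₁ 0 d₃ d₄ d₅)
    (hd1 : d₁ = ys / xs) {w ψ τ D : ℝ} (hw : c₁ * xs + c₂ * ψ = w)
    (hψ : d₁ * w + (d₃ * xs ^ 2 + d₄ * xs * ψ + d₅ * ψ ^ 2) = ψ)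
    (hτ : τ = d₄ * xs + 2 * d₅ * ψ) (hD : D = -(c₂ * d₁)) (hne : 1 - τ + D ≠ 0)
    {U : ℝ → ℝ → Prop} (hU : ∀ᶠ t in 𝓝 (τ, D), U t.1 t.2) :
    ∀ᶠ k in atTop, ∃ z L, f^[k + m] z = z ∧ HasFDerivAt f^[k + m] L z ∧
      U (planeTrace L) (planeDet L) ∧ IsSRSol f (f^[m]) N 1 m k (fun j => f^[j] z) := by
  have horb := eventually_localOrbit hlam h1 hxs hys hA hB hab hfN hr hN (w, ψ)
  have hren := c1Lim_renormalized hf hlam h1 hxs.ne' hA hB hab hhom hTay hd1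
    (horb.mono fun _ h => h.1)
  have hdiff : ∀ n, Differentiable ℝ f^[n] := fun n => (hf.iterate_self n).differentiable (by simp)
  set M := (lin 0 c₂).prod (lin d₁ (d₄ * xs + 2 * d₅ * (w, ψ).2)) with hM
  have hMt : planeTrace M = τ := by simp [planeTrace, hM, hτ]
  have hMd : planeDet M = D := by simp [planeDet, hM, hD]
  have hdet : planeDet (M - 1) ≠ 0 := by rw [planeDet_sub_one, hMt, hMd]; exact hne
  have hzero : C1Lim (fun k x => chartInv (A 0) lam xs ys k (f^[k + m] (chart (A 0) lam xs ys k x))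
      - x) (w, ψ) 0 (planeEquiv (M - 1) hdet : ℝ × ℝ →L[ℝ] ℝ × ℝ) := by
    refine (hren.sub (C1Lim.clm (1 : ℝ × ℝ →L[ℝ] ℝ × ℝ))).cast (fun _ _ => rfl) ?_
      (coe_planeEquiv _ _)
    ext <;> simp [hw, hψ]
  have hUev : ∀ᶠ q : ℕ × (ℝ × ℝ) in atTop ×ˢ 𝓝 (w, ψ),
      U (planeTrace (fderiv ℝ f^[q.1 + m] (chart (A 0) lam xs ys q.1 q.2)))
        (planeDet (fderiv ℝ f^[q.1 + m] (chart (A 0) lam xs ys q.1 q.2))) := by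
    have h2 := ((continuous_planeTrace.tendsto M).comp hren.tendsto_fderiv).prodMk_nhds
      ((continuous_planeDet.tendsto M).comp hren.tendsto_fderiv)
    rw [hMt, hMd] at h2
    refine (h2.eventually hU).mono fun q hq => ?_
    obtain ⟨L, hL, ht, hd⟩ := hasFDerivAt_conj (hdiff (q.1 + m)) hlam (A 0) xs ys q.1 q.2
    rw [← ht, ← hd]
    simpa [hL.fderiv] using hq
  have he : Tendsto (fun q : ℕ × (ℝ × ℝ) => lam ^ q.1) (atTop ×ˢ 𝓝 (w, ψ)) (𝓝 0) :=
    (tendsto_pow_atTop_nhds_zero_of_abs_lt_one h1).comp tendsto_fst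
  have hstart : Tendsto (fun q : ℕ × (ℝ × ℝ) => chart (A 0) lam xs ys q.1 q.2)
      (atTop ×ˢ 𝓝 (w, ψ)) (𝓝 (xs, 0)) := by
    have h2 := he.mul (C1Lim.chartY (A 0) xs ys h1 (w, ψ)).tendsto
    rw [zero_mul] at h2
    exact (C1Lim.chartX xs h1 (w, ψ)).tendsto.prodMk_nhds h2
  have hend : Tendsto (fun q : ℕ × (ℝ × ℝ) => f^[q.1] (chart (A 0) lam xs ys q.1 q.2))
      (atTop ×ˢ 𝓝 (w, ψ)) (𝓝 (0, ys)) := by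
    obtain ⟨hX, -, hV⟩ := C1Lim.passage (ys := ys) hlam h1 hxs.ne' hA hB hab (w, ψ)
    have h2 := (he.mul hX.tendsto).prodMk_nhds ((he.mul hV.tendsto).const_add ys)
    rw [zero_mul, zero_mul, add_zero] at h2
    refine h2.congr' (horb.mono fun q hq => ?_)
    simp only
    rw [hq.1, mul_div_cancel₀ _ (pow_ne_zero _ hlam), add_sub_cancel]
  have haxis : ∀ j, f^[j] (xs, 0) = (lam ^ j * xs, 0) := by
    intro j
    induction j with
    | zero => simp
    | succ j ih =>
      rw [Function.iterate_succ_apply', ih, hfN _ ((hN _).1 j (by simpa using hr))]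
      ext <;> simp [pow_succ', mul_assoc]
  have hper : ∀ᶠ q : ℕ × (ℝ × ℝ) in atTop ×ˢ 𝓝 (w, ψ), ∀ i, 0 < i → i < m →
      f^[i] (f^[q.1] (chart (A 0) lam xs ys q.1 q.2)) ≠ chart (A 0) lam xs ys q.1 q.2 := by
    have h2 : ∀ i ∈ Finset.Ioo 0 m, ∀ᶠ q : ℕ × (ℝ × ℝ) in atTop ×ˢ 𝓝 (w, ψ),
        f^[i] (f^[q.1] (chart (A 0) lam xs ys q.1 q.2)) ≠ chart (A 0) lam xs ys q.1 q.2 := by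
      intro i hi
      obtain ⟨hi0, him⟩ := Finset.mem_Ioo.1 hi
      refine ((((hf.continuous.iterate i).tendsto _ |>.comp hend).sub hstart).eventually_ne
        (sub_ne_zero.2 fun heq => ?_)).mono fun q hq => sub_ne_zero.1 hq
      have h3 : f^[m] (0, ys) = (lam ^ (m - i) * xs, 0) := by
        rw [← haxis, ← heq, ← Function.iterate_add_apply, Nat.sub_add_cancel him.le]
      rw [hhom] at h3
      have h4 : lam ^ (m - i) * xs = xs := (congrArg Prod.fst h3).symm
      have h5 : |lam ^ (m - i)| < 1 := by
        rw [abs_pow]; exact pow_lt_one₀ (abs_nonneg _) h1 (by omega)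
      rw [mul_eq_right₀ hxs.ne'] at h4
      rw [h4, abs_one] at h5
      exact lt_irrefl _ h5
    filter_upwards [(Finset.eventually_all _).2 h2] with q hq i hi0 him
    exact hq i (Finset.mem_Ioo.2 ⟨hi0, him⟩)
  refine (hzero.exists_zero (R := fun k x =>
    U (planeTrace (fderiv ℝ f^[k + m] (chart (A 0) lam xs ys k x)))
      (planeDet (fderiv ℝ f^[k + m] (chart (A 0) lam xs ys k x))) ∧
    (∀ j < k, f^[j] (chart (A 0) lam xs ys k x) ∈ Nset N 1) ∧
    (∀ j, 0 < j → j ≤ k → f^[j] (chart (A 0) lam xs ys k x) ≠ chart (A 0) lam xs ys k x) ∧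
    ∀ i, 0 < i → i < m →
      f^[i] (f^[k] (chart (A 0) lam xs ys k x)) ≠ chart (A 0) lam xs ys k x) ?_).mono ?_
  · filter_upwards [hUev, horb, hper] with q hq1 hq2 hq3
    exact ⟨hq1, hq2.2.1, hq2.2.2, hq3⟩
  rintro k ⟨x, hx, hUx, hNx, hret, hpx⟩
  set z := chart (A 0) lam xs ys k x with hz
  have hfix : f^[k + m] z = z := by
    rw [sub_eq_zero] at hx
    conv_rhs => rw [hz, ← hx, chart_chartInv hlam]
  refine ⟨z, _, hfix, (hdiff (k + m) z).hasFDerivAt, hUx, hfix, fun j hj0 hj => ?_,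
    fun j _ => Function.iterate_succ_apply' f j z, hNx, ?_⟩
  · rcases le_or_gt j k with hjk | hjk
    · exact hret j hj0 hjk
    · have := hpx (j - k) (by omega) (by omega)
      rwa [← Function.iterate_add_apply, Nat.sub_add_cancel hjk.le] at this
  · rw [← Function.iterate_add_apply, add_comm m k]
    exact hfix.symm

end PeriodicSolutions

theorem sufficient_conditions_orientation_preserving
    (f : ℝ × ℝ → ℝ × ℝ) (A B : ℝ → ℝ)
    (lam sig xs ys c₁ c₂ d₁ d₂ d₃ d₄ d₅ Δ : ℝ)
    (N : Set (ℝ × ℝ)) (m : ℕ)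
    (hf : ContDiff ℝ (⊤ : ℕ∞) f) (hA : ContDiff ℝ (⊤ : ℕ∞) A) (hB : ContDiff ℝ (⊤ : ℕ∞) B)
    (hlam0 : 0 < |lam|) (hlam1 : |lam| < 1) (hsig : 1 < |sig|)
    (hNopen : IsOpen N) (hNconv : Convex ℝ N) (hNbdd : Bornology.IsBounded N)
    (hN0 : ((0 : ℝ), (0 : ℝ)) ∈ N)
    (hfN : ∀ p ∈ N, f p =
      (lam * p.1 * (1 + p.1 * p.2 * A (p.1 * p.2)),
       (1 / lam) * p.2 * (1 + p.1 * p.2 * B (p.1 * p.2))))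
    (hxs : 0 < xs) (hys : 0 < ys)
    (hp1 : ((xs : ℝ), (0 : ℝ)) ∈ N) (hp2 : ((lam * xs : ℝ), (0 : ℝ)) ∈ N)
    (hp3 : ((0 : ℝ), ys / sig) ∈ N) (hp4 : ((0 : ℝ), ys / sig ^ 2) ∈ N)
    (hm : 1 ≤ m) (hhom : f^[m] (0, ys) = (xs, 0))
    (hTay : TaylorExp (f^[m]) xs ys c₁ c₂ d₁ d₂ d₃ d₄ d₅)
    (hls : lam * sig = 1) (hd1 : d₁ = ys / xs) (hd2 : d₂ = 0)
    (hab : A 0 + B 0 = 0) (hd5 : d₅ ≠ 0)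
    (hΔdef : Δ = (1 - c₂ * ys / xs - d₄ * ys / d₁) ^ 2
      - 4 * d₅ * (d₃ * xs ^ 2 + c₁ * d₁ * xs))
    (hΔ : 0 < Δ)
    (hstab1 : -1 < c₂ * ys / xs) (hstab2 : c₂ * ys / xs < 1 - Real.sqrt Δ / 2) :
    ∃ η > 0, ∃ kmin : ℕ, ∀ k : ℕ, kmin ≤ k →
      (∃ z : ℕ → ℝ × ℝ, IsSRSol f (f^[m]) N η m k z ∧ AsympStable f (z 0)) ∧
      (∃ z : ℕ → ℝ × ℝ, IsSRSol f (f^[m]) N η m k z ∧ IsSaddle f (k + m) (z 0)) := by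
  subst hd2
  have hlam : lam ≠ 0 := abs_pos.1 hlam0
  have hsig : sig = lam⁻¹ := eq_inv_of_mul_eq_one_right hls
  have hxs0 := hxs.ne'
  have hys0 := hys.ne'
  have hcd : c₂ * ys / xs = c₂ * d₁ := by rw [hd1]; ring
  have hdd : d₄ * ys / d₁ = d₄ * xs := by rw [hd1]; field_simp
  rw [hcd] at hstab1 hstab2
  rw [hcd, hdd] at hΔdef
  obtain ⟨r, hr, hN⟩ := exists_forall_near_axes_mem hNopen hNconv hN0 hlam1 hp1 hp2
    (by rw [hsig, div_inv_eq_mul, mul_comm] at hp3; exact hp3)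
    (by rw [hsig, inv_pow, div_inv_eq_mul, mul_comm] at hp4; exact hp4)
  set s := Real.sqrt Δ with hs
  have hs0 : 0 < s := Real.sqrt_pos.2 hΔ
  have hss : s ^ 2 = Δ := Real.sq_sqrt hΔ.le
  have hfix : ∀ t : ℝ, t ^ 2 = Δ → ∃ ψ : ℝ, d₄ * xs + 2 * d₅ * ψ = 1 - c₂ * d₁ + t ∧
      d₁ * (c₁ * xs + c₂ * ψ) + (d₃ * xs ^ 2 + d₄ * xs * ψ + d₅ * ψ ^ 2) = ψ := by
    intro t ht
    obtain ⟨ψ, hψ⟩ : ∃ ψ, 2 * d₅ * ψ = 1 - c₂ * d₁ - d₄ * xs + t :=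
      ⟨(1 - c₂ * d₁ - d₄ * xs + t) / (2 * d₅), by field_simp⟩
    refine ⟨ψ, by linarith, ?_⟩
    have ht' : t = 2 * d₅ * ψ - (1 - c₂ * d₁ - d₄ * xs) := by linarith
    rw [hΔdef, ht'] at ht
    refine mul_left_cancel₀ (mul_ne_zero four_ne_zero hd5) ?_
    linear_combination ht
  have hopen : ∀ {g : ℝ × ℝ → ℝ} (t : ℝ × ℝ), Continuous g → 0 < g t →
      ∀ᶠ x in nhds t, 0 < g x := fun t hg h => hg.continuousAt.eventually_const_lt h
  obtain ⟨ψ₁, hτ₁, hψ₁⟩ := hfix (-s) (by rw [neg_sq, hss])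
  obtain ⟨ψ₂, hτ₂, hψ₂⟩ := hfix s hss
  have stable := eventually_exists_isSRSol hf hlam hlam1 hxs hys hA hB hab hfN hr hN hhom hTay hd1
    rfl hψ₁ hτ₁.symm rfl (by linarith) (U := fun τ D => D < 1 ∧ |τ| < 1 + D) (by
      filter_upwards [hopen (g := fun x => 1 - x.2) (1 - c₂ * d₁ + -s, -(c₂ * d₁)) (by fun_prop)
          (by simp only; linarith),
        hopen (g := fun x => 1 + x.2 - |x.1|) (1 - c₂ * d₁ + -s, -(c₂ * d₁)) (by fun_prop) (by
          simp only
          rw [sub_pos, abs_lt]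
          exact ⟨by linarith, by linarith⟩)] with x hx1 hx2
      exact ⟨by linarith, by linarith⟩)
  have saddle := eventually_exists_isSRSol hf hlam hlam1 hxs hys hA hB hab hfN hr hN hhom hTay hd1
    rfl hψ₂ hτ₂.symm rfl (by linarith) (U := fun τ D => 1 - τ + D < 0 ∧ 0 < 1 + τ + D) (by
      filter_upwards [hopen (g := fun x => -(1 - x.1 + x.2)) (1 - c₂ * d₁ + s, -(c₂ * d₁))
          (by fun_prop) (by simp only; linarith),
        hopen (g := fun x => 1 + x.1 + x.2) (1 - c₂ * d₁ + s, -(c₂ * d₁)) (by fun_prop)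
          (by simp only; linarith)] with x hx1 hx2
      exact ⟨by linarith, by linarith⟩)
  obtain ⟨kmin, hk⟩ := eventually_atTop.1 (stable.and saddle)
  refine ⟨1, one_pos, kmin, fun k hkk => ?_⟩
  obtain ⟨⟨z, L, hz, hL, hU, hsol⟩, z', L', -, hL', hU', hsol'⟩ := hk k hkk
  exact ⟨⟨_, hsol, asympStable_of_planeTrace hf.continuous (by omega) hz hL hU.1 hU.2⟩,
    ⟨_, hsol', isSaddle_of_planeTrace hL' hU'.1 hU'.2⟩⟩
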